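/- Let A, B and C be three abelian groups. Then there exists a group S that is strongly torsion generated, has centre Z(S) isomorphic to A, satisfies H_1(S) = 0, H_2(S) ≅ B and H_3(S) ≅ C, and moreover the quotient group S/Z(S) is strongly torsion generated, has trivial centre, and satisfies H_2(S/Z(S)) ≅ A × B. -/

import Mathlib

open CategoryTheory AlgebraicTopology

/-- The chain complex (over `ℤ`) associated to the nerve of the one-object groupoid on a
group `G`, i.e. the simplicial chain complex of the classifying space `BG`; its homology in
positive degrees is the integral group homology of `G`. -/
noncomputable def classifyingComplex (G : Type) [Group G] : ChainComplex (ModuleCat ℤ) ℕ :=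
  (alternatingFaceMapComplex (ModuleCat ℤ)).obj
    (((SimplicialObject.whiskering (Type) (ModuleCat ℤ)).obj (ModuleCat.free ℤ)).obj
      (nerve (SingleObj G)))

/-- The integral group homology `H_n(G; ℤ)` of a group `G`. -/
noncomputable def grpHomology (G : Type) [Group G] (n : ℕ) : ModuleCat ℤ :=
  (classifyingComplex G).homology n

/-- A group `G` is strongly torsion generated if for every `n ≥ 2` there is an element of
order exactly `n` whose normal closure is all of `G`. -/
def StronglyTorsionGenerated (G : Type*) [Group G] : Prop :=
  ∀ n : ℕ, 2 ≤ n → ∃ g : G, orderOf g = n ∧ Subgroup.normalClosure {g} = ⊤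

namespace RCQ

/-- The coefficient group. -/
abbrev T := AddCircle (1 : ℚ)

section cochains
variable {G : Type*} [Group G] {M : Type*} [AddCommGroup M]

def Z1 (c : G → M) : Prop := ∀ g h, c (g * h) = c g + c h
def Z2 (c : G → G → M) : Prop :=
  ∀ g h k, c h k - c (g * h) k + c g (h * k) - c g h = 0
def Z3 (c : G → G → G → M) : Prop :=
  ∀ g h k l, c h k l - c (g * h) k l + c g (h * k) l - c g h (k * l) + c g h k = 0
def B2 (c : G → G → M) : Prop := ∃ f : G → M, ∀ g h, c g h = f h - f (g * h) + f g
def B3 (c : G → G → G → M) : Prop :=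
  ∃ f : G → G → M, ∀ g h k, c g h k = f h k - f (g * h) k + f g (h * k) - f g h
end cochains

def V1 (G : Type*) [Group G] : Prop := ∀ c : G → T, Z1 c → ∀ g, c g = 0
def V2 (G : Type*) [Group G] : Prop := ∀ c : G → G → T, Z2 c → B2 c
def V3 (G : Type*) [Group G] : Prop := ∀ c : G → G → G → T, Z3 c → B3 c

structure Rep2 (G : Type*) [Group G] (M : Type*) [AddCommGroup M] (κ : G → G → M) : Prop where
  coc : Z2 κ
  surj : ∀ φ : G → G → T, Z2 φ → ∃ χ : M →+ T, B2 (fun g h => φ g h - χ (κ g h))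
  inj : ∀ χ : M →+ T, B2 (fun g h => χ (κ g h)) → χ = 0

structure Rep3 (G : Type*) [Group G] (M : Type*) [AddCommGroup M] (κ : G → G → G → M) : Prop where
  coc : Z3 κ
  surj : ∀ φ : G → G → G → T, Z3 φ → ∃ χ : M →+ T, B3 (fun g h k => φ g h k - χ (κ g h k))
  inj : ∀ χ : M →+ T, B3 (fun g h k => χ (κ g h k)) → χ = 0

/-- Injectivity of the coefficient group, in the form used throughout. -/
theorem T_baer : Module.Baer ℤ T := Module.Baer.of_divisible _

theorem factor {X Y : Type*} [AddCommGroup X] [AddCommGroup Y] (d : X →+ Y) (c : X →+ T)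
    (h : ∀ x, d x = 0 → c x = 0) : ∃ f : Y →+ T, ∀ x, f (d x) = c x := by
  let q := QuotientAddGroup.kerLift d
  have hq := QuotientAddGroup.kerLift_injective d
  let c' : X ⧸ d.ker →+ T := QuotientAddGroup.lift d.ker c (fun x hx => h x hx)
  obtain ⟨f, hf⟩ := T_baer.extension_property_addMonoidHom q hq c'
  refine ⟨f, fun x => ?_⟩
  have := DFunLike.congr_fun hf (QuotientAddGroup.mk x)
  exact this

theorem sep {X : Type*} [AddCommGroup X] {x : X} (h : ∀ χ : X →+ T, χ x = 0) : x = 0 :=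
  CharacterModule.eq_zero_of_character_apply h

theorem V1.hom {G : Type*} [Group G] (hG : V1 G) {M : Type*} [AddCommGroup M] (c : G → M)
    (hc : Z1 c) (g : G) : c g = 0 := by
  refine sep fun χ => hG (fun g => χ (c g)) (fun g h => ?_) g
  simp [hc g h]

end RCQ

namespace RCQ

theorem shortComplex_aux {R : Type} [Ring R] (S : ShortComplex (ModuleCat.{0} R)) (M : Type)
    [AddCommGroup M] [Module R M] (k : S.X₂ →ₗ[R] M) (hk : ∀ x, k (S.f.hom x) = 0)
    (hi : ∀ z, S.g.hom z = 0 → k z = 0 → ∃ x, S.f.hom x = z)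
    (hs : ∀ m, ∃ z, S.g.hom z = 0 ∧ k z = m) :
    Nonempty (S.homology ≃+ M) := by
  let e1 : S.homology ≃ₗ[R] S.moduleCatLeftHomologyData.H :=
    S.moduleCatHomologyIso.toLinearEquiv
  let K := LinearMap.ker S.g.hom
  let k' : K →ₗ[R] M := k.comp K.subtype
  have hk' : LinearMap.range S.moduleCatToCycles ≤ LinearMap.ker k' := by
    rintro _ ⟨x, rfl⟩
    exact hk x
  let q : (K ⧸ LinearMap.range S.moduleCatToCycles) →ₗ[R] M := Submodule.liftQ _ k' hk'
  have hinj : Function.Injective q := by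
    rw [← LinearMap.ker_eq_bot]
    refine Submodule.ker_liftQ_eq_bot _ _ _ ?_
    rintro ⟨z, hz⟩ hkz
    obtain ⟨x, hx⟩ := hi z hz hkz
    exact ⟨x, Subtype.ext hx⟩
  have hsurj : Function.Surjective q := by
    intro m
    obtain ⟨z, hz, hm⟩ := hs m
    exact ⟨Submodule.Quotient.mk ⟨z, hz⟩, hm⟩
  exact ⟨(e1.trans (LinearEquiv.ofBijective q ⟨hinj, hsurj⟩)).toAddEquiv⟩

theorem shortComplex_homology (S : ShortComplex (ModuleCat.{0} ℤ)) (M : Type) [AddCommGroup M]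
    (k : S.X₂ →+ M) (hk : ∀ x, k (S.f.hom x) = 0)
    (hb : ∀ φ : S.X₂ →+ T, (∀ x, φ (S.f.hom x) = 0) →
      ∃ (χ : M →+ T) (ψ : S.X₃ →+ T), ∀ y, φ y = χ (k y) + ψ (S.g.hom y))
    (ha : ∀ (χ : M →+ T) (ψ : S.X₃ →+ T), (∀ y, χ (k y) = ψ (S.g.hom y)) → χ = 0) :
    Nonempty (S.homology ≃+ M) := by
  refine shortComplex_aux S M
    { toFun := k
      map_add' := k.map_add
      map_smul' := fun n x => by simpa using map_intCast_smul k ℤ ℤ n x } hk ?_ ?_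
  · intro z hz hkz
    have hkz : k z = 0 := hkz
    have : (QuotientAddGroup.mk z : S.X₂ ⧸ (S.f.hom.toAddMonoidHom.range)) = 0 := by
      refine sep fun χ => ?_
      obtain ⟨χ', ψ, h⟩ := hb (χ.comp (QuotientAddGroup.mk' _)) (fun x => by
        have : (QuotientAddGroup.mk (S.f.hom x) : S.X₂ ⧸ (S.f.hom.toAddMonoidHom.range)) = 0 :=
          (QuotientAddGroup.eq_zero_iff _).2 ⟨x, rfl⟩
        change χ (QuotientAddGroup.mk (S.f.hom x)) = 0
        rw [this, map_zero])
      have := h z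
      rw [hkz, hz, map_zero, map_zero, add_zero] at this
      exact this
    exact (QuotientAddGroup.eq_zero_iff _).1 this
  · intro m
    let K : AddSubgroup S.X₂ := S.g.hom.toAddMonoidHom.ker
    have : (QuotientAddGroup.mk m : M ⧸ (K.map k)) = 0 := by
      refine sep fun χ => ?_
      obtain ⟨ψ, hψ⟩ := factor S.g.hom.toAddMonoidHom ((χ.comp (QuotientAddGroup.mk' _)).comp k)
        (fun x hx => by
          have : (QuotientAddGroup.mk (k x) : M ⧸ (K.map k)) = 0 :=
            (QuotientAddGroup.eq_zero_iff _).2 ⟨x, hx, rfl⟩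
          change χ (QuotientAddGroup.mk (k x)) = 0
          rw [this, map_zero])
      have := ha (χ.comp (QuotientAddGroup.mk' _)) ψ (fun y => (hψ y).symm)
      exact DFunLike.congr_fun this m
    obtain ⟨x, hx, hm⟩ := (QuotientAddGroup.eq_zero_iff _).1 this
    exact ⟨x, hx, hm⟩

variable {G : Type} [Group G]

def sx1 (g : G) : ComposableArrows (SingleObj G) 1 :=
  ComposableArrows.mk₁ (X₀ := SingleObj.star G) (X₁ := SingleObj.star G) g
def sx2 (g h : G) : ComposableArrows (SingleObj G) 2 :=
  ComposableArrows.mk₂ (X₀ := SingleObj.star G) (X₁ := SingleObj.star G)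
    (X₂ := SingleObj.star G) h g
def sx3 (g h k : G) : ComposableArrows (SingleObj G) 3 :=
  ComposableArrows.mk₃ (X₀ := SingleObj.star G) (X₁ := SingleObj.star G)
    (X₂ := SingleObj.star G) (X₃ := SingleObj.star G) k h g
def sx4 (g h k l : G) : ComposableArrows (SingleObj G) 4 :=
  ComposableArrows.mk₄ (X₀ := SingleObj.star G) (X₁ := SingleObj.star G)
    (X₂ := SingleObj.star G) (X₃ := SingleObj.star G) (X₄ := SingleObj.star G) l k h g

theorem sx1_surj (x : ComposableArrows (SingleObj G) 1) : ∃ g, x = sx1 g := by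
  obtain ⟨_, _, f, rfl⟩ := x.mk₁_surjective
  exact ⟨f, rfl⟩
theorem sx2_surj (x : ComposableArrows (SingleObj G) 2) : ∃ g h, x = sx2 g h := by
  obtain ⟨_, _, _, f, f', rfl⟩ := x.mk₂_surjective
  exact ⟨f', f, rfl⟩
theorem sx3_surj (x : ComposableArrows (SingleObj G) 3) : ∃ g h k, x = sx3 g h k := by
  obtain ⟨_, _, _, _, f, f', f'', rfl⟩ := x.mk₃_surjective
  exact ⟨f'', f', f, rfl⟩
theorem sx4_surj (x : ComposableArrows (SingleObj G) 4) : ∃ g h k l, x = sx4 g h k l := by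
  obtain ⟨_, _, _, _, _, f, f', f'', f''', rfl⟩ := x.mk₄_surjective
  exact ⟨f''', f'', f', f, rfl⟩

def rd1 (x : ComposableArrows (SingleObj G) 1) : G := x.map' 0 1
def rd2 (x : ComposableArrows (SingleObj G) 2) : G × G := (x.map' 1 2, x.map' 0 1)
def rd3 (x : ComposableArrows (SingleObj G) 3) : G × G × G :=
  (x.map' 2 3, x.map' 1 2, x.map' 0 1)

theorem rd1_sx (g : G) : rd1 (sx1 g) = g := rfl
theorem rd2_sx (g h : G) : rd2 (sx2 g h) = (g, h) := rfl
theorem rd3_sx (g h k : G) : rd3 (sx3 g h k) = (g, h, k) := rfl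


theorem sx1_rd (x : ComposableArrows (SingleObj G) 1) : sx1 (rd1 x) = x := by
  obtain ⟨g, rfl⟩ := sx1_surj x; rfl
theorem sx2_rd (x : ComposableArrows (SingleObj G) 2) : sx2 (rd2 x).1 (rd2 x).2 = x := by
  obtain ⟨g, h, rfl⟩ := sx2_surj x; rfl
theorem sx3_rd (x : ComposableArrows (SingleObj G) 3) :
    sx3 (rd3 x).1 (rd3 x).2.1 (rd3 x).2.2 = x := by
  obtain ⟨g, h, k, rfl⟩ := sx3_surj x; rfl

theorem eq_sx1 {x : ComposableArrows (SingleObj G) 1} {g : G} (h : rd1 x = g) : x = sx1 g := by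
  rw [← h, sx1_rd]
theorem eq_sx2 {x : ComposableArrows (SingleObj G) 2} {g h : G} (e : rd2 x = (g, h)) :
    x = sx2 g h := by
  rw [← sx2_rd x, e]
theorem eq_sx3 {x : ComposableArrows (SingleObj G) 3} {g h k : G} (e : rd3 x = (g, h, k)) :
    x = sx3 g h k := by
  rw [← sx3_rd x, e]

theorem sx2_d0 (g h : G) : (nerve (SingleObj G)).δ (n := 1) 0 (sx2 g h) = sx1 g :=
  eq_sx1 rfl
theorem sx2_d1 (g h : G) : (nerve (SingleObj G)).δ (n := 1) 1 (sx2 g h) = sx1 (g * h) :=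
  eq_sx1 rfl
theorem sx2_d2 (g h : G) : (nerve (SingleObj G)).δ (n := 1) 2 (sx2 g h) = sx1 h :=
  eq_sx1 rfl
theorem sx3_d0 (g h k : G) : (nerve (SingleObj G)).δ (n := 2) 0 (sx3 g h k) = sx2 g h :=
  eq_sx2 rfl
theorem sx3_d1 (g h k : G) : (nerve (SingleObj G)).δ (n := 2) 1 (sx3 g h k) = sx2 g (h * k) :=
  eq_sx2 rfl
theorem sx3_d2 (g h k : G) : (nerve (SingleObj G)).δ (n := 2) 2 (sx3 g h k) = sx2 (g * h) k :=
  eq_sx2 rfl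
theorem sx3_d3 (g h k : G) : (nerve (SingleObj G)).δ (n := 2) 3 (sx3 g h k) = sx2 h k :=
  eq_sx2 rfl
theorem sx4_d0 (g h k l : G) :
    (nerve (SingleObj G)).δ (n := 3) 0 (sx4 g h k l) = sx3 g h k := eq_sx3 rfl
theorem sx4_d1 (g h k l : G) :
    (nerve (SingleObj G)).δ (n := 3) 1 (sx4 g h k l) = sx3 g h (k * l) := eq_sx3 rfl
theorem sx4_d2 (g h k l : G) :
    (nerve (SingleObj G)).δ (n := 3) 2 (sx4 g h k l) = sx3 g (h * k) l := eq_sx3 rfl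
theorem sx4_d3 (g h k l : G) :
    (nerve (SingleObj G)).δ (n := 3) 3 (sx4 g h k l) = sx3 (g * h) k l := eq_sx3 rfl
theorem sx4_d4 (g h k l : G) :
    (nerve (SingleObj G)).δ (n := 3) 4 (sx4 g h k l) = sx3 h k l := eq_sx3 rfl

/-- A basis element of the classifying complex. -/
noncomputable def bs {n : ℕ} (x : ComposableArrows (SingleObj G) n) :
    (classifyingComplex G).X n := ModuleCat.freeMk (R := ℤ) (X := (nerve (SingleObj G)).obj (.op (.mk n))) x

theorem bs_d {n : ℕ} (x : ComposableArrows (SingleObj G) (n + 1)) :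
    ((classifyingComplex G).d (n + 1) n).hom (bs x) =
      ∑ i : Fin (n + 2), (-1 : ℤ) ^ (i : ℕ) • bs ((nerve (SingleObj G)).δ i x) := by
  have key : ∀ y : ((((SimplicialObject.whiskering (Type) (ModuleCat ℤ)).obj
      (ModuleCat.free ℤ)).obj (nerve (SingleObj G)))).obj (.op (.mk (n + 1))),
      (AlternatingFaceMapComplex.objD ((((SimplicialObject.whiskering (Type) (ModuleCat ℤ)).obj
        (ModuleCat.free ℤ)).obj (nerve (SingleObj G)))) n).hom y =
      ∑ i : Fin (n + 2), (-1 : ℤ) ^ (i : ℕ) • (((((SimplicialObject.whiskering (Type)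
        (ModuleCat ℤ)).obj (ModuleCat.free ℤ)).obj (nerve (SingleObj G)))).δ i).hom y := by
    intro y
    rw [AlternatingFaceMapComplex.objD, ModuleCat.hom_sum, LinearMap.sum_apply]
    refine Finset.sum_congr rfl fun i _ => ?_
    rcases neg_one_pow_eq_or ℤ (i : ℕ) with h | h <;> rw [h]
    · rw [one_smul, one_smul]
    · rw [neg_smul, one_smul]
      refine Eq.trans ?_ (neg_one_smul ℤ _).symm
      rfl
  have h2 : (classifyingComplex G).d (n + 1) n =
    AlternatingFaceMapComplex.objD ((((SimplicialObject.whiskering (Type) (ModuleCat ℤ)).obj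
      (ModuleCat.free ℤ)).obj (nerve (SingleObj G)))) n := alternatingFaceMapComplex_obj_d _ _
  refine (congrArg (fun d => (ModuleCat.Hom.hom d) (bs x)) h2).trans ((key _).trans ?_)
  refine Finset.sum_congr rfl fun i _ => ?_
  exact congrArg _ (ModuleCat.free_map_apply _ _)

theorem hom_ext_bs {n : ℕ} {M : Type*} [AddCommGroup M]
    {φ ψ : (classifyingComplex G).X n →+ M} (h : ∀ x, φ (bs x) = ψ (bs x)) : φ = ψ := by
  refine Finsupp.addHom_ext' (M := ℤ) (f := φ) (g := ψ) fun x => ?_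
  ext
  exact h x

theorem exists_hom_bs {n : ℕ} {M : Type*} [AddCommGroup M]
    (c : ComposableArrows (SingleObj G) n → M) :
    ∃ φ : (classifyingComplex G).X n →+ M, ∀ x, φ (bs x) = c x := by
  refine ⟨Finsupp.liftAddHom (M := ℤ) (fun x => (zmultiplesHom M (c x))), fun x => ?_⟩
  refine (Finsupp.liftAddHom_apply_single (M := ℤ) (fun x => (zmultiplesHom M (c x))) x 1).trans ?_
  simp

theorem d2_bs (g h : G) : ((classifyingComplex G).d 2 1).hom (bs (sx2 g h)) =
    bs (sx1 g) - bs (sx1 (g * h)) + bs (sx1 h) := by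
  refine (bs_d (n := 1) (sx2 g h)).trans ?_
  rw [Fin.sum_univ_three, sx2_d0, sx2_d1, sx2_d2]
  simp only [Fin.val_zero, Fin.val_one, Fin.val_two]
  module

theorem d3_bs (g h k : G) : ((classifyingComplex G).d 3 2).hom (bs (sx3 g h k)) =
    bs (sx2 g h) - bs (sx2 g (h * k)) + bs (sx2 (g * h) k) - bs (sx2 h k) := by
  refine (bs_d (n := 2) (sx3 g h k)).trans ?_
  rw [Fin.sum_univ_four, sx3_d0, sx3_d1, sx3_d2, sx3_d3]
  simp only [Fin.val_zero, Fin.val_one, Fin.val_two, show ((3 : Fin 4) : ℕ) = 3 from rfl]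
  module

theorem d4_bs (g h k l : G) : ((classifyingComplex G).d 4 3).hom (bs (sx4 g h k l)) =
    bs (sx3 g h k) - bs (sx3 g h (k * l)) + bs (sx3 g (h * k) l) - bs (sx3 (g * h) k l)
      + bs (sx3 h k l) := by
  refine (bs_d (n := 3) (sx4 g h k l)).trans ?_
  rw [Fin.sum_univ_five, sx4_d0, sx4_d1, sx4_d2, sx4_d3, sx4_d4]
  simp only [Fin.val_zero, Fin.val_one, Fin.val_two, show ((3 : Fin 5) : ℕ) = 3 from rfl,
    show ((4 : Fin 5) : ℕ) = 4 from rfl]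
  module

theorem d1_bs (x : ComposableArrows (SingleObj G) 1) :
    ((classifyingComplex G).d 1 0).hom (bs x) = 0 := by
  refine (bs_d (n := 0) x).trans ?_
  rw [Fin.sum_univ_two]
  have : (nerve (SingleObj G)).δ (n := 0) 0 x = (nerve (SingleObj G)).δ (n := 0) 1 x :=
    ComposableArrows.ext₀ rfl
  rw [this]
  simp only [Fin.val_zero, Fin.val_one]
  module

theorem grpHomology_of (n : ℕ) (M : Type) [AddCommGroup M]
    (k : (classifyingComplex G).X (n + 1) →+ M)
    (hk : ∀ x, k (((classifyingComplex G).d (n + 2) (n + 1)).hom (bs x)) = 0)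
    (hb : ∀ φ : (classifyingComplex G).X (n + 1) →+ T,
      (∀ x, φ (((classifyingComplex G).d (n + 2) (n + 1)).hom (bs x)) = 0) →
      ∃ (χ : M →+ T) (ψ : (classifyingComplex G).X n →+ T), ∀ x, φ (bs x) = χ (k (bs x)) +
        ψ (((classifyingComplex G).d (n + 1) n).hom (bs x)))
    (ha : ∀ (χ : M →+ T) (ψ : (classifyingComplex G).X n →+ T), (∀ x, χ (k (bs x)) =
      ψ (((classifyingComplex G).d (n + 1) n).hom (bs x))) → χ = 0) :
    Nonempty (grpHomology G (n + 1) ≃+ M) := by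
  let S := (classifyingComplex G).sc' (n + 2) (n + 1) n
  have e : (classifyingComplex G).homology (n + 1) ≅ S.homology :=
    ShortComplex.homologyMapIso ((classifyingComplex G).isoSc' (n + 2) (n + 1) n
      (by simp) (by simp))
  let e' : grpHomology G (n + 1) ≃+ S.homology := e.toLinearEquiv.toAddEquiv
  have zero_of : ∀ {M' : Type} [AddCommGroup M'] (φ : (classifyingComplex G).X (n + 1) →+ M'),
      (∀ x, φ (((classifyingComplex G).d (n + 2) (n + 1)).hom (bs x)) = 0) →
      ∀ y, φ (((classifyingComplex G).d (n + 2) (n + 1)).hom y) = 0 := by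
    intro M' _ φ h y
    have : φ.comp ((classifyingComplex G).d (n + 2) (n + 1)).hom.toAddMonoidHom = 0 :=
      hom_ext_bs h
    exact DFunLike.congr_fun this y
  obtain ⟨e2⟩ := shortComplex_homology S M k (zero_of k hk) (by
    intro φ hφ
    obtain ⟨χ, ψ, h⟩ := hb φ (fun x => hφ _)
    refine ⟨χ, ψ, fun y => ?_⟩
    have : φ = χ.comp k + ψ.comp ((classifyingComplex G).d (n + 1) n).hom.toAddMonoidHom :=
      hom_ext_bs h
    exact DFunLike.congr_fun this y) (fun χ ψ h => ha χ ψ fun x => h _)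
  exact ⟨e'.trans e2⟩

theorem V1.grpHomology (hG : V1 G) : Subsingleton (grpHomology G 1) := by
  obtain ⟨e⟩ := grpHomology_of (G := G) 0 PUnit 0 (fun _ => rfl) (fun φ hφ => by
    refine ⟨0, 0, fun x => ?_⟩
    obtain ⟨g, rfl⟩ := sx1_surj x
    have := hG (fun g => φ (bs (sx1 g))) (fun g h => by
      have := hφ (sx2 g h)
      rw [d2_bs, map_add, map_sub] at this
      rw [← sub_eq_zero, ← neg_eq_zero, ← this]
      abel) g
    simpa using this) (fun χ _ _ => by ext ⟨⟩; simpa using map_zero χ)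
  exact e.toEquiv.subsingleton

theorem Rep2.grpHomology {M : Type} [AddCommGroup M] {κ : G → G → M} (H : Rep2 G M κ) :
    Nonempty (grpHomology G 2 ≃+ M) := by
  obtain ⟨k, hk⟩ := exists_hom_bs (G := G) (n := 2) (fun x => κ (rd2 x).1 (rd2 x).2)
  have hk' : ∀ g h, k (bs (sx2 g h)) = κ g h := fun g h => hk (sx2 g h)
  refine grpHomology_of 1 M k (fun x => ?_) (fun φ hφ => ?_) (fun χ ψ h => ?_)
  · obtain ⟨g, h, l, rfl⟩ := sx3_surj x
    rw [d3_bs, map_sub, map_add, map_sub, hk', hk', hk', hk', ← neg_eq_zero, ← H.coc g h l]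
    abel
  · obtain ⟨χ, f, hf⟩ := H.surj (fun g h => φ (bs (sx2 g h))) (fun g h l => by
      have := hφ (sx3 g h l)
      rw [d3_bs, map_sub, map_add, map_sub] at this
      rw [← neg_eq_zero, ← this]
      abel)
    obtain ⟨ψ, hψ⟩ := exists_hom_bs (G := G) (n := 1) (fun x => f (rd1 x))
    have hψ' : ∀ g, ψ (bs (sx1 g)) = f g := fun g => hψ (sx1 g)
    refine ⟨χ, ψ, fun x => ?_⟩
    obtain ⟨g, h, rfl⟩ := sx2_surj x
    rw [d2_bs, map_add, map_sub, hψ', hψ', hψ', hk', ← sub_eq_iff_eq_add']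
    refine (hf g h).trans ?_
    abel
  · refine H.inj χ ⟨fun g => ψ (bs (sx1 g)), fun g l => ?_⟩
    have := h (sx2 g l)
    rw [d2_bs, map_add, map_sub, hk'] at this
    refine this.trans ?_
    beta_reduce
    abel

theorem Rep3.grpHomology {M : Type} [AddCommGroup M] {κ : G → G → G → M} (H : Rep3 G M κ) :
    Nonempty (grpHomology G 3 ≃+ M) := by
  obtain ⟨k, hk⟩ := exists_hom_bs (G := G) (n := 3) (fun x => κ (rd3 x).1 (rd3 x).2.1 (rd3 x).2.2)
  have hk' : ∀ g h l, k (bs (sx3 g h l)) = κ g h l := fun g h l => hk (sx3 g h l)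
  refine grpHomology_of 2 M k (fun x => ?_) (fun φ hφ => ?_) (fun χ ψ h => ?_)
  · obtain ⟨g, h, l, m, rfl⟩ := sx4_surj x
    rw [d4_bs, map_add, map_sub, map_add, map_sub, hk', hk', hk', hk', hk', ← H.coc g h l m]
    abel
  · obtain ⟨χ, f, hf⟩ := H.surj (fun g h l => φ (bs (sx3 g h l))) (fun g h l m => by
      have := hφ (sx4 g h l m)
      rw [d4_bs, map_add, map_sub, map_add, map_sub] at this
      rw [← this]
      abel)
    obtain ⟨ψ, hψ⟩ := exists_hom_bs (G := G) (n := 2) (fun x => - f (rd2 x).1 (rd2 x).2)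
    have hψ' : ∀ g h, ψ (bs (sx2 g h)) = - f g h := fun g h => hψ (sx2 g h)
    refine ⟨χ, ψ, fun x => ?_⟩
    obtain ⟨g, h, l, rfl⟩ := sx3_surj x
    rw [d3_bs, map_sub, map_add, map_sub, hψ', hψ', hψ', hψ', hk', ← sub_eq_iff_eq_add']
    refine (hf g h l).trans ?_
    abel
  · refine H.inj χ ⟨fun g l => - ψ (bs (sx2 g l)), fun g l m => ?_⟩
    have := h (sx3 g l m)
    rw [d3_bs, map_sub, map_add, map_sub, hk'] at this
    refine this.trans ?_
    beta_reduce
    abel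

end RCQ

namespace RCQ

section basic
variable {G : Type*} [Group G] {K : Type*} [Group K] {M : Type*} [AddCommGroup M]
  {N : Type*} [AddCommGroup N]

theorem Z1.one {c : G → M} (h : Z1 c) : c 1 = 0 := by simpa using h 1 1
theorem Z1.inv {c : G → M} (h : Z1 c) (g : G) : c g⁻¹ = - c g := by
  have := h g⁻¹ g
  rw [inv_mul_cancel, h.one] at this
  exact (neg_eq_of_add_eq_zero_left this.symm).symm

theorem B2.add {c d : G → G → M} : B2 c → B2 d → B2 (fun g h => c g h + d g h) := by
  rintro ⟨f, hf⟩ ⟨k, hk⟩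
  exact ⟨fun g => f g + k g, fun g h => by beta_reduce; rw [hf, hk]; abel⟩
theorem B2.sub {c d : G → G → M} : B2 c → B2 d → B2 (fun g h => c g h - d g h) := by
  rintro ⟨f, hf⟩ ⟨k, hk⟩
  exact ⟨fun g => f g - k g, fun g h => by beta_reduce; rw [hf, hk]; abel⟩
theorem B2.neg {c : G → G → M} : B2 c → B2 (fun g h => - c g h) := by
  rintro ⟨f, hf⟩
  exact ⟨fun g => - f g, fun g h => by beta_reduce; rw [hf]; abel⟩
theorem B3.add {c d : G → G → G → M} : B3 c → B3 d → B3 (fun g h k => c g h k + d g h k) := by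
  rintro ⟨f, hf⟩ ⟨k, hk⟩
  exact ⟨fun g h => f g h + k g h, fun g h l => by beta_reduce; rw [hf, hk]; abel⟩
theorem B3.sub {c d : G → G → G → M} : B3 c → B3 d → B3 (fun g h k => c g h k - d g h k) := by
  rintro ⟨f, hf⟩ ⟨k, hk⟩
  exact ⟨fun g h => f g h - k g h, fun g h l => by beta_reduce; rw [hf, hk]; abel⟩
theorem B3.neg {c : G → G → G → M} : B3 c → B3 (fun g h k => - c g h k) := by
  rintro ⟨f, hf⟩
  exact ⟨fun g h => - f g h, fun g h l => by beta_reduce; rw [hf]; abel⟩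
theorem B2.congr {c d : G → G → M} (h : B2 c) (e : ∀ g h, c g h = d g h) : B2 d := by
  obtain ⟨f, hf⟩ := h
  exact ⟨f, fun g h => by rw [← e, hf]⟩
theorem B3.congr {c d : G → G → G → M} (h : B3 c) (e : ∀ g h k, c g h k = d g h k) : B3 d := by
  obtain ⟨f, hf⟩ := h
  exact ⟨f, fun g h k => by rw [← e, hf]⟩
theorem B2.comp {c : K → K → M} (h : B2 c) (j : G →* K) : B2 (fun g h => c (j g) (j h)) := by
  obtain ⟨f, hf⟩ := h
  exact ⟨fun g => f (j g), fun g h => by simp only [hf, map_mul]⟩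
theorem B3.comp {c : K → K → K → M} (h : B3 c) (j : G →* K) :
    B3 (fun g h k => c (j g) (j h) (j k)) := by
  obtain ⟨f, hf⟩ := h
  exact ⟨fun g h => f (j g) (j h), fun g h k => by simp only [hf, map_mul]⟩
theorem B2.map {c : G → G → M} (h : B2 c) (χ : M →+ N) : B2 (fun g h => χ (c g h)) := by
  obtain ⟨f, hf⟩ := h
  exact ⟨fun g => χ (f g), fun g h => by simp only [hf, map_add, map_sub]⟩
theorem B3.map {c : G → G → G → M} (h : B3 c) (χ : M →+ N) : B3 (fun g h k => χ (c g h k)) := by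
  obtain ⟨f, hf⟩ := h
  exact ⟨fun g h => χ (f g h), fun g h k => by simp only [hf, map_add, map_sub]⟩
theorem Z1.comp {c : K → M} (h : Z1 c) (j : G →* K) : Z1 (fun g => c (j g)) := by
  intro g k
  simp only [map_mul, h (j g) (j k)]
theorem Z2.comp {c : K → K → M} (h : Z2 c) (j : G →* K) : Z2 (fun g h => c (j g) (j h)) := by
  intro g k l
  simpa using h (j g) (j k) (j l)
theorem Z3.comp {c : K → K → K → M} (h : Z3 c) (j : G →* K) :
    Z3 (fun g h k => c (j g) (j h) (j k)) := by
  intro g k l m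
  simpa using h (j g) (j k) (j l) (j m)
theorem Z2.map {c : G → G → M} (h : Z2 c) (χ : M →+ N) : Z2 (fun g h => χ (c g h)) := by
  intro g k l
  simp only [← map_sub, ← map_add, h g k l, map_zero]
theorem Z3.map {c : G → G → G → M} (h : Z3 c) (χ : M →+ N) : Z3 (fun g h k => χ (c g h k)) := by
  intro g k l m
  simp only [← map_sub, ← map_add, h g k l m, map_zero]
theorem B2.Z2 {c : G → G → M} (h : B2 c) : Z2 c := by
  obtain ⟨f, hf⟩ := h
  intro g h k
  simp only [hf, mul_assoc]
  abel
theorem B3.Z3 {c : G → G → G → M} (h : B3 c) : Z3 c := by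
  obtain ⟨f, hf⟩ := h
  intro g h k l
  simp only [hf, mul_assoc]
  abel
theorem Z2.sub {c d : G → G → M} (hc : Z2 c) (hd : Z2 d) : Z2 (fun g h => c g h - d g h) := by
  intro g h k
  beta_reduce
  linear_combination (norm := abel) hc g h k - hd g h k
theorem Z2.add {c d : G → G → M} (hc : Z2 c) (hd : Z2 d) : Z2 (fun g h => c g h + d g h) := by
  intro g h k
  beta_reduce
  linear_combination (norm := abel) hc g h k + hd g h k
theorem Z3.sub {c d : G → G → G → M} (hc : Z3 c) (hd : Z3 d) :
    Z3 (fun g h k => c g h k - d g h k) := by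
  intro g h k l
  beta_reduce
  linear_combination (norm := abel) hc g h k l - hd g h k l
theorem Z3.add {c d : G → G → G → M} (hc : Z3 c) (hd : Z3 d) :
    Z3 (fun g h k => c g h k + d g h k) := by
  intro g h k l
  beta_reduce
  linear_combination (norm := abel) hc g h k l + hd g h k l

theorem Z2.norm_left {c : G → G → M} (h : Z2 c) (g : G) : c 1 g = c 1 1 := by
  have := h 1 1 g
  simp only [one_mul] at this
  linear_combination (norm := abel) this
theorem Z2.norm_right {c : G → G → M} (h : Z2 c) (g : G) : c g 1 = c 1 1 := by
  have := h g 1 1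
  simp only [mul_one] at this
  linear_combination (norm := abel) - this

theorem Z2.exists_norm {c : G → G → M} (h : Z2 c) : ∃ d : G → G → M, Z2 d ∧
    (∀ g, d 1 g = 0) ∧ (∀ g, d g 1 = 0) ∧ B2 (fun g h => c g h - d g h) := by
  refine ⟨fun g k => c g k - c 1 1, fun g k l => ?_, fun g => ?_, fun g => ?_,
    fun _ => c 1 1, fun g h => ?_⟩
  · beta_reduce; linear_combination (norm := abel) h g k l
  · beta_reduce; rw [h.norm_left, sub_self]
  · beta_reduce; rw [h.norm_right, sub_self]
  · beta_reduce; abel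

theorem Z3.exists_norm {c : G → G → G → M} (hc : Z3 c) : ∃ d : G → G → G → M, Z3 d ∧
    (∀ g h, d 1 g h = 0) ∧ (∀ g h, d g 1 h = 0) ∧ (∀ g h, d g h 1 = 0) ∧
    B3 (fun g h k => c g h k - d g h k) := by
  have hB : B3 (fun g h k => (c 1 1 k - c h 1 1) - (c 1 1 k - c (g * h) 1 1) +
    (c 1 1 (h * k) - c g 1 1) - (c 1 1 h - c g 1 1)) := ⟨fun g h => c 1 1 h - c g 1 1, fun _ _ _ => rfl⟩
  have e1 : ∀ x y, c 1 x y = c 1 1 (x * y) - c 1 1 x := fun x y => by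
    have := hc 1 1 x y
    simp only [one_mul] at this
    linear_combination (norm := abel) this
  have e3 : ∀ x y, c x y 1 = c (x * y) 1 1 - c y 1 1 := fun x y => by
    have := hc x y 1 1
    simp only [mul_one] at this
    linear_combination (norm := abel) this
  have e2 : ∀ x y, c x 1 y = c 1 1 y + c x 1 1 := fun x y => by
    have := hc x 1 1 y
    simp only [one_mul, mul_one] at this
    linear_combination (norm := abel) - this
  have e4 : c 1 1 1 = 0 := by
    have := hc 1 1 1 1
    simp only [one_mul] at this
    linear_combination (norm := abel) this
  refine ⟨fun g h k => c g h k - ((c 1 1 k - c h 1 1) - (c 1 1 k - c (g * h) 1 1) +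
    (c 1 1 (h * k) - c g 1 1) - (c 1 1 h - c g 1 1)), hc.sub hB.Z3, ?_, ?_, ?_, ?_⟩
  · intro g h
    simp only [e1 g h, one_mul]; abel
  · intro g h
    simp only [one_mul, mul_one, e2 g h, e4]; abel
  · intro g h
    simp only [mul_one, e3 g h]; abel
  · exact hB.congr fun g h k => by beta_reduce; abel

/-- Compactness: a cochain that is a coboundary on all finite sets is a coboundary. -/
theorem colim {X Y : Type*} (d : X → (Y →₀ ℤ)) (c : X → T)
    (h : ∀ s : Finset X, ∃ f : Y → T, ∀ x ∈ s,
      c x = Finsupp.liftAddHom (fun y => zmultiplesHom T (f y)) (d x)) :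
    ∃ f : Y → T, ∀ x, c x = Finsupp.liftAddHom (fun y => zmultiplesHom T (f y)) (d x) := by
  let D : (X →₀ ℤ) →+ (Y →₀ ℤ) := Finsupp.liftAddHom (fun x => zmultiplesHom _ (d x))
  let C : (X →₀ ℤ) →+ T := Finsupp.liftAddHom (fun x => zmultiplesHom _ (c x))
  obtain ⟨F, hF⟩ := factor D C (fun z hz => by
    obtain ⟨f, hf⟩ := h z.support
    have h1 : C z = Finsupp.liftAddHom (fun y => zmultiplesHom T (f y)) (D z) := by
      have hC : C z = z.sum fun x n => n • c x := rfl
      have hD : D z = z.sum fun x n => n • d x := rfl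
      rw [hC, hD, Finsupp.sum, Finsupp.sum, map_sum]
      refine Finset.sum_congr rfl fun x hx => ?_
      rw [hf x hx, map_zsmul]
    rw [h1, hz, map_zero])
  refine ⟨fun y => F (Finsupp.single y 1), fun x => ?_⟩
  have h2 : Finsupp.liftAddHom (fun y => zmultiplesHom T (F (Finsupp.single y 1))) = F := by
    ext y
    simp
  rw [h2]
  have := hF (Finsupp.single x 1)
  simp only [D, C, Finsupp.liftAddHom_apply_single, zmultiplesHom_apply, one_smul] at this
  exact this.symm

theorem ifaceB2 {c : G → G → T}
    (h : ∀ H : Subgroup G, H.FG → B2 (fun g h : H => c g h)) : B2 c := by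
  classical
  obtain ⟨f, hf⟩ := colim (X := G × G) (Y := G)
    (fun x => Finsupp.single x.2 1 - Finsupp.single (x.1 * x.2) 1 + Finsupp.single x.1 1)
    (fun x => c x.1 x.2) (fun s => by
      let H := Subgroup.closure (((s.image Prod.fst) ∪ (s.image Prod.snd) : Finset G) : Set G)
      obtain ⟨f, hf⟩ := h H ⟨_, rfl⟩
      refine ⟨fun x => if hx : x ∈ H then f ⟨x, hx⟩ else 0, fun x hx => ?_⟩
      have h1 : x.1 ∈ H := Subgroup.subset_closure (by
        simp only [Finset.coe_union, Finset.coe_image]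
        exact Or.inl ⟨x, hx, rfl⟩)
      have h2 : x.2 ∈ H := Subgroup.subset_closure (by
        simp only [Finset.coe_union, Finset.coe_image]
        exact Or.inr ⟨x, hx, rfl⟩)
      have := hf ⟨x.1, h1⟩ ⟨x.2, h2⟩
      simp only [map_add, map_sub, Finsupp.liftAddHom_apply_single, zmultiplesHom_apply, one_smul,
        dif_pos h1, dif_pos h2, dif_pos (mul_mem h1 h2)]
      exact this)
  refine ⟨f, fun g h => ?_⟩
  have := hf (g, h)
  simpa [map_add, map_sub, Finsupp.liftAddHom_apply_single, -Finsupp.liftAddHom_apply] using this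

theorem ifaceB3 {c : G → G → G → T}
    (h : ∀ H : Subgroup G, H.FG → B3 (fun g h k : H => c g h k)) : B3 c := by
  classical
  obtain ⟨f, hf⟩ := colim (X := G × G × G) (Y := G × G)
    (fun x => Finsupp.single (x.2.1, x.2.2) 1 - Finsupp.single (x.1 * x.2.1, x.2.2) 1 +
      Finsupp.single (x.1, x.2.1 * x.2.2) 1 - Finsupp.single (x.1, x.2.1) 1)
    (fun x => c x.1 x.2.1 x.2.2) (fun s => by
      let H := Subgroup.closure (((s.image (fun x => x.1)) ∪ (s.image (fun x => x.2.1)) ∪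
        (s.image (fun x => x.2.2)) : Finset G) : Set G)
      obtain ⟨f, hf⟩ := h H ⟨_, rfl⟩
      refine ⟨fun x => if hx : x.1 ∈ H ∧ x.2 ∈ H then f ⟨x.1, hx.1⟩ ⟨x.2, hx.2⟩ else 0,
        fun x hx => ?_⟩
      have h1 : x.1 ∈ H := Subgroup.subset_closure (by
        simp only [Finset.coe_union, Finset.coe_image]
        exact Or.inl (Or.inl ⟨x, hx, rfl⟩))
      have h2 : x.2.1 ∈ H := Subgroup.subset_closure (by
        simp only [Finset.coe_union, Finset.coe_image]
        exact Or.inl (Or.inr ⟨x, hx, rfl⟩))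
      have h3 : x.2.2 ∈ H := Subgroup.subset_closure (by
        simp only [Finset.coe_union, Finset.coe_image]
        exact Or.inr ⟨x, hx, rfl⟩)
      have := hf ⟨x.1, h1⟩ ⟨x.2.1, h2⟩ ⟨x.2.2, h3⟩
      simp only [map_add, map_sub, Finsupp.liftAddHom_apply_single, zmultiplesHom_apply, one_smul,
        dif_pos (And.intro h2 h3), dif_pos (And.intro h1 h2),
        dif_pos (And.intro h1 (mul_mem h2 h3)), dif_pos (And.intro (mul_mem h1 h2) h3)]
      exact this)
  refine ⟨fun g h => f (g, h), fun g h k => ?_⟩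
  have := hf (g, h, k)
  simpa [map_add, map_sub, Finsupp.liftAddHom_apply_single, -Finsupp.liftAddHom_apply] using this

end basic
end RCQ

namespace RCQ
set_option linter.all false

/-- A normalized 2-cocycle with values in a possibly twisted module. -/
structure TwCoc (S M : Type*) [Group S] [AddCommGroup M] where
  ρ : S →* AddMonoid.End M
  F : S → S → M
  coc : ∀ s t u, ρ s (F t u) - F (s * t) u + F s (t * u) - F s t = 0
  one_left : ∀ s, F 1 s = 0
  one_right : ∀ s, F s 1 = 0

/-- The group extension given by a cocycle. -/
@[ext] structure TwExt {S M : Type*} [Group S] [AddCommGroup M] (c : TwCoc S M) where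
  fst : M
  snd : S

namespace TwExt
variable {S M : Type*} [Group S] [AddCommGroup M] {c : TwCoc S M}

instance : Mul (TwExt c) := ⟨fun x y => ⟨x.fst + c.ρ x.snd y.fst + c.F x.snd y.snd, x.snd * y.snd⟩⟩
instance : One (TwExt c) := ⟨⟨0, 1⟩⟩
instance : Inv (TwExt c) := ⟨fun x => ⟨- c.ρ x.snd⁻¹ x.fst - c.F x.snd⁻¹ x.snd, x.snd⁻¹⟩⟩

theorem mul_fst (x y : TwExt c) : (x * y).fst = x.fst + c.ρ x.snd y.fst + c.F x.snd y.snd := rfl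
theorem mul_snd (x y : TwExt c) : (x * y).snd = x.snd * y.snd := rfl
theorem one_fst : (1 : TwExt c).fst = 0 := rfl
theorem one_snd : (1 : TwExt c).snd = 1 := rfl
theorem inv_fst (x : TwExt c) :
  (x⁻¹).fst = - c.ρ x.snd⁻¹ x.fst - c.F x.snd⁻¹ x.snd := rfl
theorem inv_snd (x : TwExt c) : (x⁻¹).snd = x.snd⁻¹ := rfl

instance : Group (TwExt c) := Group.ofLeftAxioms
  (fun x y z => by
    ext
    · simp only [mul_fst, mul_snd, map_add, map_mul, AddMonoid.End.coe_mul, Function.comp_apply]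
      linear_combination (norm := abel) - c.coc x.snd y.snd z.snd
    · exact mul_assoc _ _ _)
  (fun x => by
    ext
    · simp only [mul_fst, one_fst, one_snd, map_one, AddMonoid.End.coe_one, id, c.one_left]
      abel
    · exact one_mul _)
  (fun x => by
    ext
    · simp only [mul_fst, inv_fst, inv_snd, one_fst]
      abel
    · exact inv_mul_cancel _)

def proj : TwExt c →* S where
  toFun := snd
  map_one' := rfl
  map_mul' _ _ := rfl
end TwExt

/-- The cocycle datum of an untwisted normalized cocycle. -/
def Z2.tw {G : Type*} [Group G] {M : Type*} [AddCommGroup M] {φ : G → G → M} (h : Z2 φ)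
    (h1 : ∀ g, φ 1 g = 0) (h2 : ∀ g, φ g 1 = 0) : TwCoc G M where
  ρ := 1
  F := φ
  coc := h
  one_left := h1
  one_right := h2

theorem sym_coboundary {G : Type*} [CommGroup G] {φ : G → G → T} (h : Z2 φ)
    (hs : ∀ g h, φ g h = φ h g) : B2 φ := by
  obtain ⟨d, hd, h1, h2, hB⟩ := h.exists_norm
  suffices B2 d from (hB.add this).congr fun g h => by beta_reduce; abel
  have hsd : ∀ g h, d g h = d h g := by
    obtain ⟨f, hf⟩ := hB
    intro x y
    have e1 := hf x y
    have e2 := hf y x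
    beta_reduce at e1 e2
    rw [hs, mul_comm] at e1
    linear_combination (norm := abel) e2 - e1
  let c := hd.tw h1 h2
  have cm : ∀ x y : TwExt c, x * y = y * x := fun x y => by
    ext
    · have e1 : (x * y).fst = x.fst + y.fst + d x.snd y.snd := rfl
      have e2 : (y * x).fst = y.fst + x.fst + d y.snd x.snd := rfl
      rw [e1, e2, hsd]
      abel
    · exact mul_comm _ _
  letI : CommGroup (TwExt c) := { (inferInstance : Group (TwExt c)) with mul_comm := cm }
  let i : T →+ Additive (TwExt c) :=
    { toFun := fun t => Additive.ofMul ⟨t, 1⟩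
      map_zero' := rfl
      map_add' := fun a b => by
        apply Additive.toMul.injective
        ext
        · change a + b = a + b + d 1 1
          rw [h1, add_zero]
        · exact (one_mul (1 : G)).symm }
  have hi : Function.Injective i := fun a b hab => congrArg (fun x => (Additive.toMul x).fst) hab
  obtain ⟨r, hr⟩ := T_baer.extension_property_addMonoidHom i hi (AddMonoidHom.id T)
  have hr' : ∀ t, r (i t) = t := fun t => DFunLike.congr_fun hr t
  refine ⟨fun g => r (Additive.ofMul ⟨0, g⟩), fun g k => ?_⟩
  have e : (Additive.ofMul (⟨0, g⟩ : TwExt c)) + Additive.ofMul ⟨0, k⟩ =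
      i (d g k) + Additive.ofMul ⟨0, g * k⟩ := by
    apply Additive.toMul.injective
    ext
    · change 0 + 0 + d g k = d g k + 0 + d 1 (g * k)
      rw [h1]
      abel
    · exact (one_mul (g * k)).symm
  have := congrArg r e
  rw [map_add, map_add, hr'] at this
  linear_combination (norm := abel) -this

/-- A central extension of `Q` by `B`. -/
structure CExt (U Q B : Type*) [Group U] [Group Q] [AddCommGroup B] where
  π : U →* Q
  surj : Function.Surjective π
  j : B → U
  j_add : ∀ a b, j (a + b) = j a * j b
  j_inj : Function.Injective j
  π_j : ∀ b, π (j b) = 1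
  ker : ∀ u, π u = 1 → ∃ b, j b = u
  central : ∀ b u, j b * u = u * j b

namespace CExt
variable {U Q B : Type*} [Group U] [Group Q] [AddCommGroup B] (E : CExt U Q B)

theorem j_zero : E.j 0 = 1 := by simpa using E.j_add 0 0

theorem exists_section : ∃ s : Q → U, s 1 = 1 ∧ ∀ q, E.π (s q) = q := by
  classical
  choose s hs using E.surj
  refine ⟨fun q => if q = 1 then 1 else s q, by simp, fun q => ?_⟩
  by_cases h : q = 1
  · simp [h]
  · simp [h, hs]

noncomputable def s : Q → U := E.exists_section.choose
theorem s_one : E.s 1 = 1 := E.exists_section.choose_spec.1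
theorem π_s (q : Q) : E.π (E.s q) = q := E.exists_section.choose_spec.2 q

theorem exists_β (x : U) : ∃ b, E.j b * E.s (E.π x) = x := by
  obtain ⟨b, hb⟩ := E.ker (x * (E.s (E.π x))⁻¹) (by rw [map_mul, map_inv, E.π_s, mul_inv_cancel])
  exact ⟨b, by rw [hb, inv_mul_cancel_right]⟩
noncomputable def β (x : U) : B := (E.exists_β x).choose
theorem j_β (x : U) : E.j (E.β x) * E.s (E.π x) = x := (E.exists_β x).choose_spec
theorem eq_β {x : U} {b : B} (h : E.j b * E.s (E.π x) = x) : E.β x = b :=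
  E.j_inj (mul_right_cancel ((E.j_β x).trans h.symm))
theorem β_j (b : B) : E.β (E.j b) = b := E.eq_β (by rw [E.π_j, E.s_one, mul_one])
theorem β_mul_j (x : U) (b : B) : E.β (x * E.j b) = E.β x + b := E.eq_β (by
  rw [map_mul, E.π_j, mul_one, E.j_add, mul_assoc, E.central b, ← mul_assoc, E.j_β])

noncomputable def κ (q r : Q) : B := E.β (E.s q * E.s r)
theorem j_κ (q r : Q) : E.j (E.κ q r) * E.s (q * r) = E.s q * E.s r := by
  have := E.j_β (E.s q * E.s r)
  rwa [map_mul, E.π_s, E.π_s] at this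
theorem β_mul (x y : U) : E.β (x * y) = E.β x + E.β y + E.κ (E.π x) (E.π y) := E.eq_β (by
  rw [E.j_add, map_mul, mul_assoc, E.j_κ, E.j_add, E.central (E.β x), mul_assoc,
    ← mul_assoc (E.j (E.β x)), E.j_β, ← mul_assoc, E.central, mul_assoc, E.j_β])

theorem κ_coc : Z2 E.κ := by
  have : B2 (fun x y => E.κ (E.π x) (E.π y)) := ⟨fun x => - E.β x, fun x y => by
    beta_reduce
    rw [E.β_mul]; abel⟩
  intro q r t
  simpa [E.π_s] using this.Z2 (E.s q) (E.s r) (E.s t)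

theorem V1Q (E : CExt U Q B) (h : V1 U) : V1 Q := by
  intro c hc q
  have := h _ (hc.comp E.π) (E.s q)
  rwa [E.π_s] at this

theorem rep2 (h1 : V1 U) (h2 : V2 U) : Rep2 Q B E.κ where
  coc := E.κ_coc
  surj := by
    intro φ hφ
    obtain ⟨d, hd, n1, n2, hB⟩ := hφ.exists_norm
    obtain ⟨f, hf⟩ := h2 _ (hd.comp E.π)
    beta_reduce at hf
    have hfj : ∀ b x, f (E.j b * x) = f (E.j b) + f x := fun b x => by
      have := hf (E.j b) x
      rw [E.π_j, n1] at this
      linear_combination (norm := abel) this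
    let χ : B →+ T := AddMonoidHom.mk' (fun b => f (E.j b)) (fun a b => by rw [E.j_add, hfj])
    refine ⟨-χ, (hB.add ⟨fun q => f (E.s q), fun q r => ?_⟩ : B2 (fun g h => φ g h - d g h +
      (d g h - (-χ) (E.κ g h)))).congr fun g h => by beta_reduce; abel⟩
    have e1 := hf (E.s q) (E.s r)
    rw [E.π_s, E.π_s, ← E.j_κ, hfj] at e1
    change d q r - (- f (E.j (E.κ q r))) = _
    rw [e1]
    abel
  inj := by
    rintro χ ⟨f, hf⟩
    beta_reduce at hf
    have hZ : Z1 (fun x => χ (E.β x) + f (E.π x)) := fun x y => by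
      have := hf (E.π x) (E.π y)
      beta_reduce
      rw [E.β_mul, map_add, map_add, this, map_mul]
      abel
    ext b
    have f1 : f 1 = 0 := by
      have e := hf 1 1
      have : E.κ 1 1 = 0 := by
        rw [κ, E.s_one, one_mul, ← E.j_zero, E.β_j]
      rw [this, map_zero, one_mul] at e
      linear_combination (norm := abel) - e
    have := h1 _ hZ (E.j b)
    beta_reduce at this
    rw [E.β_j, E.π_j, f1, add_zero] at this
    exact this

theorem V3Q (E : CExt U Q B) (h1 : V1 U) (h3 : V3 U) : V3 Q := by
  intro φ hφ
  obtain ⟨c, hc, n1, n2, n3, hB⟩ := hφ.exists_norm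
  suffices B3 c from (hB.add this).congr fun g h k => by beta_reduce; abel
  obtain ⟨f0, hf0⟩ := h3 _ (hc.comp E.π)
  obtain ⟨f, hf, hl, hr⟩ : ∃ f : U → U → T, (∀ x y z, c (E.π x) (E.π y) (E.π z) =
      f y z - f (x * y) z + f x (y * z) - f x y) ∧ (∀ x, f 1 x = 0) ∧ (∀ x, f x 1 = 0) := by
    refine ⟨fun x y => f0 x y - f0 1 1, fun x y z => ?_, fun x => ?_, fun x => ?_⟩
    · beta_reduce; refine (hf0 x y z).trans ?_; abel
    · beta_reduce
      have := hf0 1 1 x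
      simp only [map_one, n1, one_mul] at this
      linear_combination (norm := abel) - this
    · beta_reduce
      have := hf0 x 1 1
      simp only [map_one, n3, mul_one] at this
      linear_combination (norm := abel) this
  have hω : ∀ b x, f x (E.j b) = f (E.j b) x := by
    intro b x
    have := h1 (fun x => f x (E.j b) - f (E.j b) x) (fun x y => by
      have e1 := hf x y (E.j b)
      have e2 := hf x (E.j b) y
      have e3 := hf (E.j b) x y
      rw [E.π_j, n3] at e1
      rw [E.π_j, n2] at e2
      rw [E.π_j, n1] at e3
      rw [E.central] at e2 e3
      beta_reduce
      linear_combination (norm := abel) e1 - e2 + e3) x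
    exact sub_eq_zero.1 this
  obtain ⟨g, hg⟩ : ∃ g : B → T, ∀ a b, f (E.j a) (E.j b) = g b - g (a + b) + g a := by
    obtain ⟨g, hg⟩ := sym_coboundary (G := Multiplicative B)
      (φ := fun a b => f (E.j a.toAdd) (E.j b.toAdd)) (fun a b d => by
        have := hf (E.j a.toAdd) (E.j b.toAdd) (E.j d.toAdd)
        rw [E.π_j, n1] at this
        simp only [toAdd_mul, E.j_add]
        exact this.symm) (fun a b => hω _ _)
    exact ⟨fun b => g (Multiplicative.ofAdd b), fun a b => hg (Multiplicative.ofAdd a)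
      (Multiplicative.ofAdd b)⟩
  let γ : U → T := fun x => g (E.β x) - f (E.s (E.π x)) (E.j (E.β x))
  let F : U → U → T := fun x y => f x y - (γ y - γ (x * y) + γ x)
  have hF : ∀ x y z, c (E.π x) (E.π y) (E.π z) =
      F y z - F (x * y) z + F x (y * z) - F x y := fun x y z => by
    simp only [F, mul_assoc]
    rw [hf x y z]
    abel
  have F0 : ∀ x b, F x (E.j b) = 0 := by
    intro x b
    have e1 := hg (E.β x) b
    have e2 := hf (E.s (E.π x)) (E.j (E.β x)) (E.j b)
    rw [E.π_j, n2, ← E.central, E.j_β, ← E.j_add] at e2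
    simp only [F, γ, E.β_j, E.π_j, E.s_one, hl, E.β_mul_j, map_mul, mul_one]
    linear_combination (norm := abel) e2 + e1
  have F1 : ∀ x b, F (E.j b) x = 0 := by
    intro x b
    rw [← F0 x b]
    simp only [F, hω, E.central]
    abel
  have R : ∀ x y b, F x (E.j b * y) = F x y := by
    intro x y b
    have := hF x y (E.j b)
    rw [E.π_j, n3, F0, F0, ← E.central] at this
    linear_combination (norm := abel) - this
  have L : ∀ x y b, F (E.j b * x) y = F x y := by
    intro x y b
    have := hF (E.j b) x y
    rw [E.π_j, n1, F1, F1] at this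
    linear_combination (norm := abel) this
  refine ⟨fun q r => F (E.s q) (E.s r), fun q r t => ?_⟩
  have := hF (E.s q) (E.s r) (E.s t)
  simp only [E.π_s] at this
  rw [this, ← E.j_κ, ← E.j_κ, L, R]

end CExt
end RCQ

namespace RCQ
set_option linter.all false

section null
variable {G K : Type*} [Group G] [Group K]
def Null1 (j : G →* K) : Prop := ∀ c : K → T, Z1 c → ∀ g, c (j g) = 0
def Null2 (j : G →* K) : Prop := ∀ c : K → K → T, Z2 c → B2 (fun g h => c (j g) (j h))
def Null3 (j : G →* K) : Prop := ∀ c : K → K → K → T, Z3 c → B3 (fun g h k => c (j g) (j h) (j k))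
end null

section cross
variable {G0 G H : Type*} [Group G0] [Group G] [Group H] {M : Type*} [AddCommGroup M]

theorem cross2 (c : G × H → G × H → T) (hc : Z2 c) (j : G0 →* G) (hj : Null1 j) :
    B2 (fun p q : G0 × H => c (j p.1, p.2) (j q.1, q.2) - c (j p.1, 1) (j q.1, 1)
      - c (1, p.2) (1, q.2)) := by
  have hω : ∀ h g, c (1, h) (j g, 1) - c (j g, 1) (1, h) = 0 := by
    intro h g
    refine hj (fun g => c (1, h) (g, 1) - c (g, 1) (1, h)) (fun g1 g2 => ?_) g
    beta_reduce
    have h1 := hc (1, h) (g1, 1) (g2, 1)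
    have h2 := hc (g1, 1) (1, h) (g2, 1)
    have h3 := hc (g1, 1) (g2, 1) (1, h)
    simp only [Prod.mk_mul_mk, one_mul, mul_one] at h1 h2 h3
    linear_combination (norm := abel) h1 - h2 + h3
  have n1 := hc.norm_left
  have n2 := hc.norm_right
  refine ⟨fun p => - c (j p.1, 1) (1, p.2), ?_⟩
  rintro ⟨g1, h1⟩ ⟨g2, h2⟩
  have := hω h1 g2
  have k1 := hc (j g1, 1) (1, h1) (j g2, 1) 
  have k2 := hc (j g1, 1) (j g2, 1) (1, h1)
  have k3 := hc (j g1 * j g2, 1) (1, h1) (1, h2)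
  have k4 := hc (j g1, h1) (j g2, 1) (1, h2)
  simp only [Prod.mk_mul_mk, one_mul, mul_one, map_mul, mul_assoc] at k1 k2 k3 k4 ⊢
  linear_combination (norm := abel) - k1 + k2 - k3 + k4 + this

theorem cross3core (c : G × H → G × H → G × H → T) (hc : Z3 c) 
    (n1 : ∀ g h, c 1 g h = 0) (n2 : ∀ g h, c g 1 h = 0) (n3 : ∀ g h, c g h 1 = 0)
    (hy : ∀ h : H, B2 (fun g1 g2 => c (1, h) (g1, 1) (g2, 1) - c (g1, 1) (1, h) (g2, 1)
      + c (g1, 1) (g2, 1) (1, h)))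
    (j : G0 →* G) (hj : Null1 j) :
    B3 (fun p q r : G0 × H => c (j p.1, p.2) (j q.1, q.2) (j r.1, r.2)
      - c (j p.1, 1) (j q.1, 1) (j r.1, 1) - c (1, p.2) (1, q.2) (1, r.2)) := by
  choose θ hθ using hy
  beta_reduce at hθ
  have hx : ∀ h1 h2 g, c (1, h1) (1, h2) (j g, 1) - c (1, h1) (j g, 1) (1, h2)
      + c (j g, 1) (1, h1) (1, h2) + (θ h2 (j g) - θ (h1 * h2) (j g) + θ h1 (j g)) = 0 := by
    intro h1 h2 g
    refine hj (fun g => c (1, h1) (1, h2) (g, 1) - c (1, h1) (g, 1) (1, h2)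
      + c (g, 1) (1, h1) (1, h2) + (θ h2 g - θ (h1 * h2) g + θ h1 g)) (fun g1 g2 => ?_) g
    beta_reduce
    have k1 := hc (1, h1) (1, h2) (g1, 1) (g2, 1)
    have k2 := hc (1, h1) (g1, 1) (1, h2) (g2, 1)
    have k3 := hc (1, h1) (g1, 1) (g2, 1) (1, h2)
    have k4 := hc (g1, 1) (1, h1) (1, h2) (g2, 1)
    have k5 := hc (g1, 1) (1, h1) (g2, 1) (1, h2)
    have k6 := hc (g1, 1) (g2, 1) (1, h1) (1, h2)
    have t1 := hθ h1 g1 g2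
    have t2 := hθ h2 g1 g2
    have t3 := hθ (h1 * h2) g1 g2
    simp only [Prod.mk_mul_mk, one_mul, mul_one] at k1 k2 k3 k4 k5 k6
    linear_combination (norm := abel) -k1 + k2 - k3 - k4 + k5 - k6 + t1 + t2 - t3
  refine ⟨fun p q => - c (j p.1, 1) (1, p.2) (j q.1, 1) + c (j p.1, 1) (j q.1, 1) (1, p.2)
    - c ((j p.1 * j q.1), 1) (1, p.2) (1, q.2) + c (j p.1, p.2) (j q.1, 1) (1, q.2)
    - θ p.2 (j q.1), ?_⟩
  rintro ⟨g1', h1⟩ ⟨g2', h2⟩ ⟨g3', h3⟩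
  have t1 := hx h1 h2 g3'
  have t2 := hθ h1 (j g2') (j g3')
  simp only [Prod.mk_mul_mk, map_mul]
  generalize j g1' = g1 at *
  generalize j g2' = g2 at *
  generalize j g3' = g3 at *
  have k1 := hc (g1, 1) (1, h1) (g2, 1) (g3, 1)
  have k2 := hc (g1, 1) (g2, 1) (1, h1) (g3, 1)
  have k3 := hc (g1, 1) (g2, 1) (g3, 1) (1, h1)
  have k4 := hc ((g1 * g2), 1) (1, h1) (1, h2) (g3, 1)
  have k5 := hc ((g1 * g2), 1) (1, h1) (g3, 1) (1, h2)
  have k6 := hc ((g1 * g2), 1) (g3, 1) (1, h1) (1, h2)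
  have k7 := hc ((g1 * g2 * g3), 1) (1, h1) (1, h2) (1, h3)
  have k8 := hc (g1, h1) (g2, 1) (1, h2) (g3, 1)
  have k9 := hc (g1, h1) (g2, 1) (g3, 1) (1, h2)
  have k10 := hc (g1, h1) ((g2 * g3), 1) (1, h2) (1, h3)
  have k11 := hc (g1, h1) (g2, h2) (g3, 1) (1, h3)
  simp only [Prod.mk_mul_mk, one_mul, mul_one, mul_assoc] at k1 k2 k3 k4 k5 k6 k7 k8 k9 k10 k11 ⊢
  linear_combination (norm := abel) - k1 + k2 - k3 - k4 + k5 - k6 - k7 + k8 - k9 + k10 - k11 + t1 + t2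

theorem yZ2 (c : G × H → G × H → G × H → M) (hc : Z3 c) (h : H) :
    Z2 (fun g1 g2 => c (1, h) (g1, 1) (g2, 1) - c (g1, 1) (1, h) (g2, 1)
      + c (g1, 1) (g2, 1) (1, h)) := by
  intro g1 g2 g3
  have k1 := hc (1, h) (g1, 1) (g2, 1) (g3, 1)
  have k2 := hc (g1, 1) (1, h) (g2, 1) (g3, 1)
  have k3 := hc (g1, 1) (g2, 1) (1, h) (g3, 1)
  have k4 := hc (g1, 1) (g2, 1) (g3, 1) (1, h)
  simp only [Prod.mk_mul_mk, one_mul, mul_one] at k1 k2 k3 k4 ⊢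
  linear_combination (norm := abel) - k1 + k2 - k3 + k4

/-- passing to normalized cocycles in the conclusion of the cross lemmas -/
theorem cross_norm {c d : G × H → G × H → G × H → M} (h : B3 (fun x y z => c x y z - d x y z))
    (j : G0 →* G)
    (hd : B3 (fun p q r : G0 × H => d (j p.1, p.2) (j q.1, q.2) (j r.1, r.2)
      - d (j p.1, 1) (j q.1, 1) (j r.1, 1) - d (1, p.2) (1, q.2) (1, r.2))) :
    B3 (fun p q r : G0 × H => c (j p.1, p.2) (j q.1, q.2) (j r.1, r.2)
      - c (j p.1, 1) (j q.1, 1) (j r.1, 1) - c (1, p.2) (1, q.2) (1, r.2)) := by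
  have e1 := h.comp (j.prodMap (MonoidHom.id H))
  have e2 := h.comp ((MonoidHom.inl G H).comp (j.comp (MonoidHom.fst G0 H)))
  have e3 := h.comp ((MonoidHom.inr G H).comp (MonoidHom.snd G0 H))
  refine (hd.add ((e1.sub e2).sub e3)).congr fun p q r => ?_
  simp [Prod.map]
  abel

theorem cross3null {G1 : Type*} [Group G1] (c : G × H → G × H → G × H → T) (hc : Z3 c)
    (j0 : G0 →* G1) (h0 : Null1 j0) (j1 : G1 →* G) (h1 : Null2 j1) :
    B3 (fun p q r : G0 × H => c (j1 (j0 p.1), p.2) (j1 (j0 q.1), q.2) (j1 (j0 r.1), r.2)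
      - c (j1 (j0 p.1), 1) (j1 (j0 q.1), 1) (j1 (j0 r.1), 1) - c (1, p.2) (1, q.2) (1, r.2)) := by
  obtain ⟨d, hd, n1, n2, n3, hcd⟩ := hc.exists_norm
  refine cross_norm hcd (j1.comp j0) ?_
  have hm := hd.comp (j1.prodMap (MonoidHom.id H))
  have e1 : ∀ h : H, j1.prodMap (MonoidHom.id H) (1, h) = (1, h) := fun h => by simp
  refine (cross3core (fun x y z => d (j1.prodMap (MonoidHom.id H) x) (j1.prodMap (MonoidHom.id H) y)
    (j1.prodMap (MonoidHom.id H) z)) hm ?_ ?_ ?_ ?_ j0 h0).congr ?_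
  · intro g h; simp only [map_one, n1]
  · intro g h; simp only [map_one, n2]
  · intro g h; simp only [map_one, n3]
  · intro h
    refine (h1 _ (yZ2 d hd h)).congr fun g1 g2 => ?_
    simp
  · intro p q r
    simp

theorem cross3V (c : G × H → G × H → G × H → T) (hc : Z3 c) (hG : V1 G) (hH : V1 H) :
    B3 (fun p q r : G × H => c p q r
      - c (p.1, 1) (q.1, 1) (r.1, 1) - c (1, p.2) (1, q.2) (1, r.2)) := by
  obtain ⟨d, hd, n1, n2, n3, hcd⟩ := hc.exists_norm
  refine cross_norm hcd (MonoidHom.id G) ?_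
  refine cross3core d hd n1 n2 n3 ?_ (MonoidHom.id G) (fun c hc g => hG c hc g)
  -- the classes of `y h` form a homomorphism
  let BB : AddSubgroup (G → G → T) :=
    { carrier := {c | B2 c}
      zero_mem' := ⟨0, fun g h => by simp⟩
      add_mem' := fun {a b} ha hb => B2.add ha hb
      neg_mem' := fun {a} ha => B2.neg ha }
  let y : H → G → G → T := fun h g1 g2 => d (1, h) (g1, 1) (g2, 1) - d (g1, 1) (1, h) (g2, 1)
      + d (g1, 1) (g2, 1) (1, h)
  have := hH.hom (fun h => (QuotientAddGroup.mk (y h) : (G → G → T) ⧸ BB)) (fun h1 h2 => by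
    rw [← QuotientAddGroup.mk_add, QuotientAddGroup.eq]
    refine ⟨fun g => -(d (1, h1) (1, h2) (g, 1) - d (1, h1) (g, 1) (1, h2)
      + d (g, 1) (1, h1) (1, h2)), fun g1 g2 => ?_⟩
    simp only [Pi.add_apply, Pi.neg_apply, y]
    have k1 := hd (1, h1) (1, h2) (g1, 1) (g2, 1)
    have k2 := hd (1, h1) (g1, 1) (1, h2) (g2, 1)
    have k3 := hd (1, h1) (g1, 1) (g2, 1) (1, h2)
    have k4 := hd (g1, 1) (1, h1) (1, h2) (g2, 1)
    have k5 := hd (g1, 1) (1, h1) (g2, 1) (1, h2)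
    have k6 := hd (g1, 1) (g2, 1) (1, h1) (1, h2)
    simp only [Prod.mk_mul_mk, one_mul, mul_one] at k1 k2 k3 k4 k5 k6
    linear_combination (norm := abel) k1 - k2 + k3 + k4 - k5 + k6)
  intro h
  exact (QuotientAddGroup.eq_zero_iff (y h)).1 (this h)

theorem cross2V (c : G × H → G × H → T) (hc : Z2 c) (hG : V1 G) :
    B2 (fun p q : G × H => c p q - c (p.1, 1) (q.1, 1) - c (1, p.2) (1, q.2)) :=
  cross2 c hc (MonoidHom.id G) (fun c hc g => hG c hc g)
end cross

section conj
variable {G K : Type*} [Group G] [Group K] {M : Type*} [AddCommGroup M]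

theorem conj2 {c : K → K → M} (hc : Z2 c) (u : K) (τ σ : G →* K) (h : ∀ g, u * τ g = σ g * u) :
    B2 (fun g k => c (σ g) (σ k) - c (τ g) (τ k)) := by
  refine ⟨fun g => -(c u (τ g) - c (σ g) u), fun g k => ?_⟩
  have k1 := hc u (τ g) (τ k)
  have k2 := hc (σ g) u (τ k)
  have k3 := hc (σ g) (σ k) u
  simp only [h, map_mul] at *
  linear_combination (norm := abel) - k1 + k2 - k3

theorem conj3 {c : K → K → K → M} (hc : Z3 c) (u : K) (τ σ : G →* K)
    (h : ∀ g, u * τ g = σ g * u) :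
    B3 (fun g k l => c (σ g) (σ k) (σ l) - c (τ g) (τ k) (τ l)) := by
  refine ⟨fun g k => -(c u (τ g) (τ k) - c (σ g) u (τ k) + c (σ g) (σ k) u), fun g k l => ?_⟩
  have k1 := hc u (τ g) (τ k) (τ l)
  have k2 := hc (σ g) u (τ k) (τ l)
  have k3 := hc (σ g) (σ k) u (τ l)
  have k4 := hc (σ g) (σ k) (σ l) u
  simp only [h, map_mul] at *
  linear_combination (norm := abel) - k1 + k2 - k3 + k4
end conj

section mitosis
variable {G G0 G1 K : Type*} [Group G] [Group G0] [Group G1] [Group K]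

/-- mitosis data -/
structure Mit (i τ : G →* K) (u : K) : Prop where
  comm : ∀ g h, Commute (i g) (τ h)
  conj : ∀ g, u * τ g = i g * τ g * u

variable {i τ : G →* K} {u : K}

theorem Mit.null1 (m : Mit i τ u) : Null1 i := by
  intro c hc g
  have := congrArg c (m.conj g)
  rw [hc, hc, hc] at this
  linear_combination (norm := abel) - this

def Mit.sig (m : Mit i τ u) : G →* K := (MonoidHom.noncommCoprod i τ m.comm).comp
  ((MonoidHom.id G).prod (MonoidHom.id G))

theorem Mit.null2 (m : Mit i τ u) (j : G0 →* G) (hj : Null1 j) : Null2 (i.comp j) := by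
  intro c hc
  have h1 := conj2 hc u τ m.sig (fun g => by simp [Mit.sig, m.conj])
  have h2 := cross2 _ (hc.comp (MonoidHom.noncommCoprod i τ m.comm)) j hj
  have h3 := h2.comp ((MonoidHom.id G0).prod j)
  refine ((h1.comp j).sub h3).congr fun g k => ?_
  simp [Mit.sig]

theorem Mit.null3 (m : Mit i τ u) (j0 : G0 →* G1) (h0 : Null1 j0) (j1 : G1 →* G) (h1 : Null2 j1) :
    Null3 (i.comp (j1.comp j0)) := by
  intro c hc
  have h1' := conj3 hc u τ m.sig (fun g => by simp [Mit.sig, m.conj])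
  have h2 := cross3null _ (hc.comp (MonoidHom.noncommCoprod i τ m.comm)) j0 h0 j1 h1
  have h3 := h2.comp ((MonoidHom.id G0).prod (j1.comp j0))
  refine ((h1'.comp (j1.comp j0)).sub h3).congr fun g k l => ?_
  simp [Mit.sig]
end mitosis
end RCQ

namespace RCQ
set_option linter.all false

section UU
variable (A W : Type) [AddCommGroup A] [Zero W]

abbrev XX := A × (ℕ →₀ W)

variable {A W}

theorem XX.ext' {p q : XX A W} (h1 : p.1 = q.1) (h2 : ∀ j, p.2 j = q.2 j) : p = q :=
  Prod.ext h1 (Finsupp.ext h2)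

noncomputable def eF (j : ℕ) (f : W → W) (p : XX A W) : XX A W := (p.1, p.2.update j (f (p.2 j)))

@[simp] theorem eF_fst (j : ℕ) (f : W → W) (p : XX A W) : (eF j f p).1 = p.1 := rfl
theorem eF_snd (j : ℕ) (f : W → W) (p : XX A W) (i : ℕ) :
    (eF j f p).2 i = if i = j then f (p.2 j) else p.2 i := by
  classical
  rw [eF, Finsupp.update_apply]
@[simp] theorem eF_same (j : ℕ) (f : W → W) (p : XX A W) : (eF j f p).2 j = f (p.2 j) := by
  simp [eF_snd]
theorem eF_ne {j i : ℕ} (h : i ≠ j) (f : W → W) (p : XX A W) : (eF j f p).2 i = p.2 i := by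
  simp [eF_snd, h]

theorem eF_comp (j : ℕ) (f g : W → W) (p : XX A W) : eF j f (eF j g p) = eF j (f ∘ g) p := by
  refine XX.ext' rfl fun i => ?_
  simp only [eF_snd]
  split_ifs <;> simp
theorem eF_id (j : ℕ) (p : XX A W) : eF j id p = p := by
  refine XX.ext' rfl fun i => ?_
  simp only [eF_snd]
  split_ifs with h <;> simp [h]
theorem eF_comm {j i : ℕ} (h : i ≠ j) (f g : W → W) (p : XX A W) :
    eF j f (eF i g p) = eF i g (eF j f p) := by
  refine XX.ext' rfl fun l => ?_
  simp only [eF_snd]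
  split_ifs <;> simp_all

noncomputable def ee (j : ℕ) : Equiv.Perm W →* Equiv.Perm (XX A W) where
  toFun π :=
    { toFun := eF j π
      invFun := eF j ⇑π⁻¹
      left_inv := fun p => by
        rw [eF_comp]
        have : (⇑π⁻¹ ∘ ⇑π) = id := by funext; simp
        rw [this, eF_id]
      right_inv := fun p => by
        rw [eF_comp]
        have : (⇑π ∘ ⇑π⁻¹) = id := by funext; simp
        rw [this, eF_id] }
  map_one' := by ext1 p; exact eF_id j p
  map_mul' := fun π σ => by ext1 p; exact (eF_comp j π σ p).symm

theorem ee_apply (j : ℕ) (π : Equiv.Perm W) (p : XX A W) : ee j π p = eF j π p := rfl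

def trF (a : A) (p : XX A W) : XX A W := (a + p.1, p.2)
@[simp] theorem trF_fst (a : A) (p : XX A W) : (trF a p).1 = a + p.1 := rfl
@[simp] theorem trF_snd (a : A) (p : XX A W) : (trF a p).2 = p.2 := rfl

structure Lv (k : ℕ) (σ : Equiv.Perm (XX A W)) : Prop where
  tr : ∀ a p, σ (trF a p) = trF a (σ p)
  coord : ∀ j, k ≤ j → ∀ p, (σ p).2 j = p.2 j
  comm : ∀ j, k ≤ j → ∀ π : Equiv.Perm W, ∀ p, σ (eF j π p) = eF j π (σ p)

theorem Lv.mono {k l : ℕ} (h : k ≤ l) {σ : Equiv.Perm (XX A W)} (hσ : Lv k σ) : Lv l σ :=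
  ⟨hσ.tr, fun j hj => hσ.coord j (h.trans hj), fun j hj => hσ.comm j (h.trans hj)⟩

theorem Lv.one (k : ℕ) : Lv k (1 : Equiv.Perm (XX A W)) :=
  ⟨fun _ _ => rfl, fun _ _ _ => rfl, fun _ _ _ _ => rfl⟩
theorem Lv.mul {k : ℕ} {σ τ : Equiv.Perm (XX A W)} (hσ : Lv k σ) (hτ : Lv k τ) : Lv k (σ * τ) := by
  refine ⟨fun a p => ?_, fun j hj p => ?_, fun j hj π p => ?_⟩
  · rw [Equiv.Perm.mul_apply, hτ.tr, hσ.tr]; rfl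
  · rw [Equiv.Perm.mul_apply, hσ.coord j hj, hτ.coord j hj]
  · rw [Equiv.Perm.mul_apply, hτ.comm j hj, hσ.comm j hj]; rfl
theorem Lv.inv {k : ℕ} {σ : Equiv.Perm (XX A W)} (hσ : Lv k σ) : Lv k σ⁻¹ := by
  refine ⟨fun a p => ?_, fun j hj p => ?_, fun j hj π p => ?_⟩
  · apply σ.injective; rw [hσ.tr]; simp
  · rw [← hσ.coord j hj]; simp
  · apply σ.injective; rw [hσ.comm j hj]; simp

variable (A W) in
/-- The acyclic group. -/
def UU : Subgroup (Equiv.Perm (XX A W)) where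
  carrier := {σ | ∃ k, Lv k σ}
  one_mem' := ⟨0, Lv.one 0⟩
  mul_mem' := by
    rintro σ τ ⟨k, hk⟩ ⟨l, hl⟩
    exact ⟨max k l, (hk.mono (le_max_left _ _)).mul (hl.mono (le_max_right _ _))⟩
  inv_mem' := by
    rintro σ ⟨k, hk⟩
    exact ⟨k, hk.inv⟩

theorem ee_lv (j : ℕ) (π : Equiv.Perm W) : Lv (j + 1) (ee (A := A) j π) := by
  refine ⟨fun a p => ?_, fun i hi p => ?_, fun i hi σ p => ?_⟩
  · rfl
  · rw [ee_apply, eF_ne (by omega)]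
  · rw [ee_apply, ee_apply, eF_comm (by omega)]

variable (A) in
/-- `ee` with values in `UU`. -/
noncomputable def eU (j : ℕ) : Equiv.Perm W →* UU A W :=
  (ee j).codRestrict (UU A W) (fun π => ⟨j + 1, ee_lv j π⟩)

theorem eU_apply (j : ℕ) (π : Equiv.Perm W) (p : XX A W) : (eU A j π).1 p = eF j π p := rfl

theorem UU.ext {σ τ : UU A W} (h : ∀ p, σ.1 p = τ.1 p) : σ = τ :=
  Subtype.ext (Equiv.ext h)

/-- translations -/
def tr : Multiplicative A →* UU A W where
  toFun a := ⟨{ toFun := trF a.toAdd, invFun := trF (- a.toAdd),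
                left_inv := fun p => by simp [trF], right_inv := fun p => by simp [trF] },
    0, fun b p => by
      refine Prod.ext ?_ rfl
      show a.toAdd + (b + p.1) = b + (a.toAdd + p.1)
      abel, fun _ _ _ => rfl, fun _ _ _ _ => rfl⟩
  map_one' := UU.ext fun p => by simp [trF]
  map_mul' a b := UU.ext fun p => by
    refine Prod.ext ?_ rfl
    show (a * b).toAdd + p.1 = a.toAdd + (b.toAdd + p.1)
    rw [toAdd_mul, add_assoc]

theorem tr_apply (a : Multiplicative A) (p : XX A W) : (tr a : UU A W).1 p = trF a.toAdd p := rfl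

theorem tr_central (a : Multiplicative A) (σ : UU A W) : tr a * σ = σ * tr a := by
  obtain ⟨σ, k, hσ⟩ := σ
  exact UU.ext fun p => (hσ.tr _ _).symm

theorem tr_inj : Function.Injective (tr : Multiplicative A →* UU A W) := by
  intro a b h
  have := congrArg (fun σ : UU A W => (σ.1 (0, 0)).1) h
  simp only [tr_apply, trF, add_zero] at this
  exact this

theorem eU_tr (j : ℕ) (π : Equiv.Perm W) (a : Multiplicative A) (h : eU A j π = tr a) : π = 1 := by
  ext w
  have := congrArg (fun σ : UU A W => (σ.1 (0, Finsupp.single j w)).2 j) h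
  simpa [tr_apply, eU_apply] using this

theorem eU_inj (j : ℕ) : Function.Injective (eU (W := W) A j) :=
  (injective_iff_map_eq_one _).2 fun π h => eU_tr j π (1 : Multiplicative A) (by rw [map_one]; exact h)

/-- The binate structure. -/
theorem binate {Γ : Type*} [Group Γ] (i : Γ →* UU A W) (k : ℕ) (hi : ∀ γ, Lv k (i γ).1)
    (τ : Γ →* Equiv.Perm W) (χ : W → Γ) (hχ : ∀ γ w, χ (τ γ w) = γ * χ w) :
    ∃ u : UU A W, Lv (k + 1) u.1 ∧ Mit i ((eU A k).comp τ) u := by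
  let u : Equiv.Perm (XX A W) :=
    { toFun := fun p => (i (χ (p.2 k))).1 p
      invFun := fun p => (i (χ (p.2 k)))⁻¹.1 p
      left_inv := fun p => by
        beta_reduce
        rw [(hi _).coord k le_rfl]; simp
      right_inv := fun p => by
        have := (hi (χ (p.2 k))).inv.coord k le_rfl p
        beta_reduce
        rw [InvMemClass.coe_inv, this]; simp }
  have hu : Lv (k + 1) u := by
    refine ⟨fun a p => ?_, fun j hj p => ?_, fun j hj π p => ?_⟩
    · exact (hi _).tr a p
    · exact (hi _).coord j (by omega) p
    · show (i (χ ((eF j π p).2 k))).1 (eF j π p) = eF j π ((i (χ (p.2 k))).1 p)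
      rw [eF_ne (by omega)]
      exact (hi _).comm j (by omega) π p
  refine ⟨⟨u, k + 1, hu⟩, hu, fun g h => UU.ext fun p => ?_, fun g => UU.ext fun p => ?_⟩
  · exact (hi g).comm k le_rfl (τ h) p
  · show (i (χ ((eF k (τ g) p).2 k))).1 (eF k (τ g) p) =
      (i g).1 (eF k (τ g) ((i (χ (p.2 k))).1 p))
    rw [eF_same, hχ, ← (hi _).comm k le_rfl, map_mul]
    rfl

/-- small subgroups -/
def Small (H : Subgroup (UU A W)) : Prop := Countable H ∧ ∃ k, ∀ h ∈ H, Lv k h.1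

theorem countable_closure {G : Type*} [Group G] {s : Set G} (hs : s.Countable) :
    Countable (Subgroup.closure s) := by
  have := hs.to_subtype
  have h1 : Countable (FreeGroup s) := inferInstanceAs (Countable (Quot _))
  have h2 : Subgroup.closure s = (FreeGroup.lift ((↑) : s → G)).range := by
    rw [FreeGroup.range_lift_eq_closure]; simp
  rw [h2]
  exact (MonoidHom.rangeRestrict_surjective _).countable

theorem lv_closure {s : Set (UU A W)} {k : ℕ} (h : ∀ x ∈ s, Lv k x.1) :
    ∀ x ∈ Subgroup.closure s, Lv k x.1 := by
  intro x hx
  induction hx using Subgroup.closure_induction with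
  | mem x hx => exact h x hx
  | one => exact Lv.one k
  | mul x y _ _ h1 h2 => exact h1.mul h2
  | inv x _ h1 => exact h1.inv

theorem fg_small {H : Subgroup (UU A W)} (h : H.FG) : Small H := by
  obtain ⟨s, rfl⟩ := h
  refine ⟨countable_closure s.countable_toSet, ?_⟩
  choose f hf using fun x : UU A W => x.2
  exact ⟨s.sup f, lv_closure fun x hx => (hf x).mono (Finset.le_sup (f := f) hx)⟩

variable [Infinite W]

theorem equivProd (H W : Type) [Infinite W] [Nonempty H] (h : Cardinal.mk H ≤ Cardinal.mk W) :
    Nonempty (H × W ≃ W) := by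
  rw [← Cardinal.eq, Cardinal.mk_prod, Cardinal.lift_id, Cardinal.lift_id]
  exact Cardinal.mul_eq_right (Cardinal.aleph0_le_mk W) h (Cardinal.mk_ne_zero H)

/-- regular representation of a group on `W` -/
theorem regRep (H W : Type) [Group H] [Infinite W] (h : Cardinal.mk H ≤ Cardinal.mk W) :
    ∃ (τ : H →* Equiv.Perm W) (χ : W → H), (∀ γ w, χ (τ γ w) = γ * χ w) := by
  obtain ⟨E⟩ := equivProd H W h
  refine ⟨{ toFun := fun h => (E.symm.trans ((Equiv.mulLeft h).prodCongr (Equiv.refl W))).trans E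
            map_one' := ?_
            map_mul' := ?_ }, fun w => (E.symm w).1, ?_⟩
  · ext w; simp
  · intro x y; ext w; simp [mul_assoc, Prod.map]
  · intro γ w; simp

theorem small_step {H : Subgroup (UU A W)} (h : Small H) :
    ∃ (H' : Subgroup (UU A W)) (hle : H ≤ H') (_ : Small H') (τ : H →* H') (u : H'),
      Mit (Subgroup.inclusion hle) τ u := by
  obtain ⟨hc, k, hk⟩ := h
  obtain ⟨τ, χ, hχ⟩ := regRep H W ((Cardinal.mk_le_aleph0).trans (Cardinal.aleph0_le_mk W))
  obtain ⟨u, hu, hm⟩ := binate H.subtype k (fun γ => hk _ γ.2) τ χ hχ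
  let s : Set (UU A W) := (H : Set (UU A W)) ∪ Set.range ((eU A k).comp τ) ∪ {u}
  have hs : ∀ x ∈ s, x ∈ Subgroup.closure s := fun x hx => Subgroup.subset_closure hx
  refine ⟨Subgroup.closure s, fun x hx => hs x (Or.inl (Or.inl hx)), ⟨countable_closure ?_, k + 1,
    lv_closure ?_⟩, ((eU A k).comp τ).codRestrict _ (fun x => hs _ (Or.inl (Or.inr ⟨x, rfl⟩))),
    ⟨u, hs _ (Or.inr rfl)⟩, fun g h => Subtype.ext (hm.comm g h), fun g => Subtype.ext (hm.conj g)⟩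
  · have h1 : (H : Set (UU A W)).Countable := hc
    exact (h1.union (Set.countable_range _)).union (Set.countable_singleton u)
  · rintro x ((hx | ⟨y, rfl⟩) | rfl)
    · exact (hk x hx).mono (by omega)
    · exact ee_lv k (τ y)
    · exact hu

theorem null1_step {H : Subgroup (UU A W)} (h : Small H) :
    ∃ (H' : Subgroup (UU A W)) (hle : H ≤ H') (_ : Small H'), Null1 (Subgroup.inclusion hle) := by
  obtain ⟨H', hle, hs, τ, u, m⟩ := small_step h
  exact ⟨H', hle, hs, m.null1⟩

theorem null2_step {H : Subgroup (UU A W)} (h : Small H) :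
    ∃ (H' : Subgroup (UU A W)) (hle : H ≤ H') (_ : Small H'), Null2 (Subgroup.inclusion hle) := by
  obtain ⟨H1, hle1, hs1, n1⟩ := null1_step h
  obtain ⟨H', hle, hs, τ, u, m⟩ := small_step hs1
  exact ⟨H', hle1.trans hle, hs, m.null2 _ n1⟩

theorem null3_step {H : Subgroup (UU A W)} (h : Small H) :
    ∃ (H' : Subgroup (UU A W)) (hle : H ≤ H') (_ : Small H'), Null3 (Subgroup.inclusion hle) := by
  obtain ⟨H1, hle1, hs1, n1⟩ := null1_step h
  obtain ⟨H2, hle2, hs2, n2⟩ := null2_step hs1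
  obtain ⟨H', hle, hs, τ, u, m⟩ := small_step hs2
  exact ⟨H', (hle1.trans hle2).trans hle, hs, m.null3 _ n1 _ n2⟩

theorem UU_V1 : V1 (UU A W) := by
  intro c hc g
  obtain ⟨H', hle, _, n⟩ := null1_step (fg_small (A := A) (W := W)
    (H := Subgroup.closure {g}) ⟨{g}, by simp⟩)
  exact n _ (hc.comp H'.subtype) ⟨g, Subgroup.subset_closure rfl⟩

theorem UU_V2 : V2 (UU A W) := by
  intro c hc
  refine ifaceB2 fun H hH => ?_
  obtain ⟨H', hle, _, n⟩ := null2_step (fg_small hH)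
  exact n _ (hc.comp H'.subtype)

theorem UU_V3 : V3 (UU A W) := by
  intro c hc
  refine ifaceB3 fun H hH => ?_
  obtain ⟨H', hle, _, n⟩ := null3_step (fg_small hH)
  exact n _ (hc.comp H'.subtype)

end UU
end RCQ

namespace RCQ
set_option linter.all false

section STG
variable {A W : Type} [AddCommGroup A] [Zero W]

/-- swapping coordinates -/
noncomputable def swF (j : ℕ) (p : XX A W) : XX A W :=
  (p.1, Finsupp.equivMapDomain (Equiv.swap 0 j) p.2)

theorem swF_fst (j : ℕ) (p : XX A W) : (swF j p).1 = p.1 := rfl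
theorem swF_snd (j : ℕ) (p : XX A W) (i : ℕ) : (swF j p).2 i = p.2 (Equiv.swap 0 j i) := by
  rw [swF, Finsupp.equivMapDomain_apply, Equiv.symm_swap]

noncomputable def swp (j : ℕ) : UU A W :=
  ⟨{ toFun := swF j
     invFun := swF j
     left_inv := fun p => XX.ext' rfl fun i => by simp [swF_snd]
     right_inv := fun p => XX.ext' rfl fun i => by simp [swF_snd] }, j + 1,
   ⟨fun a p => rfl, fun i hi p => by
      show (swF j p).2 i = p.2 i
      rw [swF_snd, Equiv.swap_apply_of_ne_of_ne (by omega) (by omega)],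
    fun i hi π p => XX.ext' rfl fun l => by
      show (swF j (eF i π p)).2 l = (eF i π (swF j p)).2 l
      rw [swF_snd, eF_snd, eF_snd, swF_snd, swF_snd,
        Equiv.swap_apply_of_ne_of_ne (a := 0) (b := j) (x := i) (by omega) (by omega)]
      have : Equiv.swap 0 j l = i ↔ l = i := by
        rw [Equiv.swap_apply_def]; split_ifs <;> omega
      simp only [this]⟩⟩

theorem swp_conj (j : ℕ) (π : Equiv.Perm W) :
    (swp j : UU A W) * eU A 0 π = eU A j π * swp j := by
  refine UU.ext fun p => XX.ext' rfl fun l => ?_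
  show (swF j (eF 0 π p)).2 l = (eF j π (swF j p)).2 l
  rw [swF_snd, eF_snd, eF_snd, swF_snd, swF_snd, Equiv.swap_apply_right]
  have : Equiv.swap 0 j l = 0 ↔ l = j := by
    rw [Equiv.swap_apply_def]; split_ifs <;> omega
  simp only [this]

theorem zpowersHom_mem_closure {G : Type*} [Group G] (h : G) (γ : Multiplicative ℤ) :
    zpowersHom G h γ ∈ Subgroup.closure {h} := by
  rw [zpowersHom_apply]
  exact Subgroup.zpow_mem _ (Subgroup.subset_closure (Set.mem_singleton h)) _

theorem normal_conj {G : Type*} [Group G] {N : Subgroup G} [N.Normal] {x y u : G}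
    (h : u * x = y * u) (hx : x ∈ N) : y ∈ N := by
  have := Subgroup.Normal.conj_mem ‹N.Normal› x hx u
  rwa [h, mul_inv_cancel_right] at this

/-- A shift-like element normally generates. -/
theorem shift_gen (π : Equiv.Perm W) (χ : W → ℤ) (hχ : ∀ w, χ (π w) = χ w + 1)
    (N : Subgroup (UU A W)) [N.Normal] (h0 : eU A 0 π ∈ N) : N = ⊤ := by
  rw [eq_top_iff]
  rintro h -
  obtain ⟨k, hk⟩ := h.2
  have hz : ∀ γ : Multiplicative ℤ, Lv k (zpowersHom (UU A W) h γ).1 := by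
    intro γ
    exact lv_closure (s := {h}) (k := k) (fun x hx => by rw [Set.mem_singleton_iff.1 hx]; exact hk) _
      (zpowersHom_mem_closure h γ)
  have hχ' : ∀ (n : ℤ) w, χ ((π ^ n) w) = n + χ w := by
    have h1 : ∀ w, χ (π⁻¹ w) = χ w - 1 := fun w => by
      have := hχ (π⁻¹ w)
      have e : π (π⁻¹ w) = w := by simp
      rw [e] at this
      omega
    intro n
    induction n using Int.induction_on with
    | zero => intro w; simp
    | succ n ih => intro w; rw [zpow_add_one, Equiv.Perm.mul_apply, ih, hχ]; ring
    | pred n ih => intro w; rw [zpow_sub_one, Equiv.Perm.mul_apply, ih, h1]; ring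
  obtain ⟨u, -, m⟩ := binate (zpowersHom (UU A W) h) k hz (zpowersHom _ π)
    (fun w => Multiplicative.ofAdd (χ w)) (fun γ w => by
      rw [zpowersHom_apply, hχ', ofAdd_add]; rfl)
  have hs : eU A k π ∈ N := normal_conj (swp_conj k π) h0
  have := m.conj (Multiplicative.ofAdd 1)
  simp only [MonoidHom.comp_apply, zpowersHom_apply, toAdd_ofAdd, zpow_one] at this
  have h2 := normal_conj this hs
  exact (Subgroup.mul_mem_cancel_right N hs).1 h2

variable [Infinite W]

/-- cyclic permutations -/
theorem exists_cyc (W : Type) [Infinite W] (n : ℕ) (hn : 2 ≤ n) :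
    ∃ (a t : Equiv.Perm W) (χ : W → ℤ), orderOf a = n ∧
      ∀ w, χ ((a * t * a⁻¹ * t⁻¹) w) = χ w + 1 := by
  have : NeZero n := ⟨by omega⟩
  have h1n : (1 : ZMod n) ≠ 0 := by
    have : Fact (1 < n) := ⟨by omega⟩
    exact one_ne_zero
  obtain ⟨E⟩ := equivProd (ZMod n → ℤ) W
    (Cardinal.mk_le_aleph0.trans (Cardinal.aleph0_le_mk W))
  let L : Equiv.Perm (ZMod n → ℤ) →* Equiv.Perm W :=
    { toFun := fun h => (E.symm.trans (h.prodCongr (Equiv.refl W))).trans E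
      map_one' := by ext w; simp
      map_mul' := fun x y => by ext w; simp [Prod.map] }
  have hL : Function.Injective L := by
    intro x y h
    ext1 f
    have := DFunLike.congr_fun h (E (f, (Classical.arbitrary W)))
    simp [L] at this
    exact this
  let R : Multiplicative (ZMod n) →* Equiv.Perm (ZMod n → ℤ) :=
    { toFun := fun m => 
        { toFun := fun f x => f (x - m.toAdd), invFun := fun f x => f (x + m.toAdd)
          left_inv := fun f => by funext x; simp
          right_inv := fun f => by funext x; simp }
      map_one' := by ext f x; simp
      map_mul' := fun x y => by 
        ext f z
        show f (z - (x * y).toAdd) = f (z - x.toAdd - y.toAdd)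
        rw [toAdd_mul, sub_sub] }
  have hR : Function.Injective R := by
    intro x y h
    have h2 := congrFun (DFunLike.congr_fun h (Pi.single 0 1)) x.toAdd
    change (Pi.single 0 1 : ZMod n → ℤ) (x.toAdd - x.toAdd) = (Pi.single 0 1 : ZMod n → ℤ) (x.toAdd - y.toAdd) at h2
    rw [sub_self, Pi.single_eq_same, Pi.single_apply] at h2
    have h3 : x.toAdd - y.toAdd = 0 := by
      by_contra hne
      rw [if_neg hne] at h2
      exact one_ne_zero h2
    exact Multiplicative.toAdd.injective (sub_eq_zero.1 h3)
  let t : Equiv.Perm (ZMod n → ℤ) := Equiv.addRight (Pi.single 0 1)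
  refine ⟨L (R (Multiplicative.ofAdd 1)), L t, fun w => (E.symm w).1 1, ?_, fun w => ?_⟩
  · rw [orderOf_injective L hL, orderOf_injective R hR, orderOf_ofAdd_eq_addOrderOf,
      ZMod.addOrderOf_one]
  · rw [← map_inv L, ← map_inv L, ← map_mul L, ← map_mul L, ← map_mul L]
    beta_reduce
    have : ∀ x f, (E.symm (L x f)).1 = x (E.symm f).1 := by intro x f; simp [L]
    rw [this]
    show (((E.symm w).1 + - (Pi.single 0 1 : ZMod n → ℤ)) (1 - 1 + 1) + (Pi.single 0 1 : ZMod n → ℤ) (1 - 1)) = _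
    simp [h1n]

theorem eU_gen {n : ℕ} {a t : Equiv.Perm W} {χ : W → ℤ}
    (hχ : ∀ w, χ ((a * t * a⁻¹ * t⁻¹) w) = χ w + 1)
    (N : Subgroup (UU A W)) [hN : N.Normal] (h0 : eU A 0 a ∈ N) : N = ⊤ := by
  refine shift_gen _ χ hχ N ?_
  have h1 := hN.conj_mem _ (N.inv_mem h0) (eU A 0 t)
  have := N.mul_mem h0 h1
  simpa [mul_assoc] using this

theorem UU_stg_quot {Q : Type} [Group Q] (f : UU A W →* Q) (hf : Function.Surjective f)
    (hk : ∀ σ, f σ = 1 → ∃ a, σ = tr a) : StronglyTorsionGenerated Q := by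
  intro n hn
  obtain ⟨a, t, χ, ha, hχ⟩ := exists_cyc W n hn
  refine ⟨f (eU A 0 a), ?_, ?_⟩
  · rw [← ha]
    refine orderOf_injective (f.comp (eU A 0)) ((injective_iff_map_eq_one _).2 fun π h => ?_) a
    obtain ⟨b, hb⟩ := hk _ h
    exact eU_tr 0 π b hb
  · have := eU_gen (n := n) hχ ((Subgroup.normalClosure {f (eU A 0 a)}).comap f)
      (Subgroup.subset_normalClosure rfl)
    rw [eq_top_iff]
    rintro q -
    obtain ⟨x, rfl⟩ := hf q
    have hx : x ∈ (⊤ : Subgroup (UU A W)) := trivial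
    rw [← this] at hx
    exact hx

open Classical in
/-- test elements for the centre computation -/
noncomputable def test (k : ℕ) (x : ℕ →₀ W) (w : W) : UU A W := by
  classical
  let F : XX A W → XX A W := fun p =>
    if ∀ i < k, p.2 i = x i then eF k (Equiv.swap (x k) w) p else p
  have hF : ∀ p, F (F p) = p := by
    intro p
    by_cases h : ∀ i < k, p.2 i = x i
    · have h' : ∀ i < k, (eF k (Equiv.swap (x k) w) p).2 i = x i := fun i hi => by
        rw [eF_ne (by omega), h i hi]
      simp only [F, if_pos h, if_pos h', eF_comp]
      have : (⇑(Equiv.swap (x k) w) ∘ ⇑(Equiv.swap (x k) w)) = id := by funext; simp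
      rw [this, eF_id]
    · simp only [F, if_neg h]
  refine ⟨⟨F, F, hF, hF⟩, k + 1, fun a p => ?_, fun j hj p => ?_, fun j hj π p => ?_⟩
  · show F _ = trF a (F p)
    by_cases h : ∀ i < k, p.2 i = x i
    · have h' : ∀ i < k, (trF a p).2 i = x i := h
      simp only [F, if_pos h, if_pos h']; rfl
    · have h' : ¬ ∀ i < k, (trF a p).2 i = x i := h
      simp only [F, if_neg h, if_neg h']
  · show (F p).2 j = _
    simp only [F]
    split_ifs
    · rw [eF_ne (by omega)]
    · rfl
  · show F _ = eF j π (F p)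
    have : (∀ i < k, (eF j π p).2 i = x i) ↔ (∀ i < k, p.2 i = x i) := by
      refine forall_congr' fun i => forall_congr' fun hi => ?_
      rw [eF_ne (by omega)]
    simp only [F, this]
    split_ifs
    · rw [eF_comm (by omega)]
    · rfl

open Classical in
theorem test_pos (k : ℕ) (x : ℕ →₀ W) (w : W) (p : XX A W) (h : ∀ i < k, p.2 i = x i) :
    (test k x w).1 p = eF k (Equiv.swap (x k) w) p := by
  classical
  exact if_pos h
open Classical in
theorem test_neg (k : ℕ) (x : ℕ →₀ W) (w : W) (p : XX A W) (h : ¬ ∀ i < k, p.2 i = x i) :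
    (test k x w).1 p = p := by
  classical
  exact if_neg h

open Classical in
theorem UU_center (c : UU A W) (hc : ∀ u, ∃ a, c * u = tr a * (u * c)) : ∃ a, c = tr a := by
  obtain ⟨k, hk⟩ := c.2
  have h1 : ∀ p, (c.1 p).2 = p.2 := by
    intro p
    by_contra hne
    have hne' : ¬ ∀ i < k, (c.1 p).2 i = p.2 i := by
      intro h
      refine hne (Finsupp.ext fun i => ?_)
      rcases lt_or_ge i k with hi | hi
      · exact h i hi
      · exact hk.coord i hi p
    obtain ⟨w, hw⟩ := exists_ne (p.2 k)
    obtain ⟨a, ha⟩ := hc (test k p.2 w)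
    have h2 := congrArg (fun σ : UU A W => (σ.1 p).2 k) ha
    change (c.1 ((test k p.2 w).1 p)).2 k = ((test k p.2 w).1 (c.1 p)).2 k at h2
    rw [test_neg _ _ _ _ hne', test_pos _ _ _ _ (fun _ _ => rfl), hk.coord k le_rfl,
      hk.coord k le_rfl, eF_same, Equiv.swap_apply_left] at h2
    exact hw h2
  let α : (ℕ →₀ W) → A := fun x => (c.1 (0, x)).1
  have hα : ∀ p, c.1 p = (p.1 + α p.2, p.2) := by
    intro p
    have h2 := hk.tr p.1 (0, p.2)
    have h3 : trF p.1 (0, p.2) = p := by simp [trF]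
    rw [h3] at h2
    rw [h2]
    refine Prod.ext rfl ?_
    exact h1 _
  have hup : ∀ x j w, α (x.update j w) = α x := by
    intro x j w
    obtain ⟨a, ha⟩ := hc (eU A j (Equiv.swap (x j) w))
    have h2 : ∀ p, c.1 (eF j (Equiv.swap (x j) w) p) = trF a.toAdd (eF j (Equiv.swap (x j) w) (c.1 p)) :=
      fun p => congrArg (fun σ : UU A W => σ.1 p) ha
    obtain ⟨v, hv⟩ := Infinite.exists_notMem_finset ({x j, w} : Finset W)
    simp only [Finset.mem_insert, Finset.mem_singleton, not_or] at hv
    have h3 := congrArg Prod.fst (h2 (0, x.update j v))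
    have h4 := congrArg Prod.fst (h2 (0, x))
    have e1 : eF j (Equiv.swap (x j) w) ((0, x) : XX A W) = (0, x.update j w) := by
      simp [eF]
    have e2 : eF j (Equiv.swap (x j) w) ((0, x.update j v) : XX A W) = (0, x.update j v) := by
      refine XX.ext' rfl fun i => ?_
      rw [eF_snd]
      split_ifs with h
      · subst h
        simp [Equiv.swap_apply_of_ne_of_ne hv.1 hv.2]
      · rfl
    rw [e1] at h4
    rw [e2] at h3
    simp only [hα, trF_fst, eF_fst, zero_add] at h3 h4
    rw [h4]
    have : a.toAdd = 0 := by
      exact left_eq_add.1 (by rw [add_comm] at h3; exact h3)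
    rw [this, zero_add]
  have hconst : ∀ (s : Finset ℕ) (x : ℕ →₀ W), x.support ⊆ s → α x = α 0 := by
    intro s
    induction s using Finset.induction_on with
    | empty =>
      intro x hx
      rw [Finset.subset_empty, Finsupp.support_eq_empty] at hx
      rw [hx]
    | insert j s hj ih =>
      intro x hx
      rw [← hup x j 0]
      refine ih _ ?_
      rw [Finsupp.support_update_zero]
      intro i hi
      rw [Finset.mem_erase] at hi
      have := hx hi.2
      rw [Finset.mem_insert] at this
      tauto
  refine ⟨Multiplicative.ofAdd (α 0), UU.ext fun p => ?_⟩
  rw [hα, hconst _ p.2 le_rfl, add_comm]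
  rfl

end STG
end RCQ

namespace RCQ
set_option linter.all false

section amalgam
variable {V : Type} [Group V] (L : Subgroup V)

abbrev YY := {p : V ⧸ L // p ≠ (1 : V)}
abbrev FY := FreeGroup (YY L)

variable {L}

open Classical in
noncomputable def br (p : V ⧸ L) : FY L := if h : p = (1 : V) then 1 else FreeGroup.of ⟨p, h⟩

theorem br_one : br (((1 : V) : V ⧸ L)) = 1 := by classical exact dif_pos rfl
theorem br_of (y : YY L) : br y.1 = FreeGroup.of y := by classical exact dif_neg y.2

theorem FY_ext {E : Type*} [Monoid E] {f g : FY L →* E} (h : ∀ p, f (br p) = g (br p)) : f = g := by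
  ext y
  have := h y.1
  rwa [br_of] at this

theorem lift_br {E : Type*} [Group E] (θ : V ⧸ L → E) (h : θ (1 : V) = 1) (p : V ⧸ L) :
    FreeGroup.lift (fun y : YY L => θ y.1) (br p) = θ p := by
  by_cases hp : p = (1 : V)
  · subst hp; rw [br_one, map_one, h]
  · rw [br_of ⟨p, hp⟩, FreeGroup.lift_apply_of]

noncomputable def actH (u : V) : FY L →* FY L :=
  FreeGroup.lift (fun y : YY L => (br (u : V ⧸ L))⁻¹ * br (u • y.1))

theorem actH_br (u : V) (p : V ⧸ L) : actH u (br p) = (br (u : V ⧸ L))⁻¹ * br (u • p) := by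
  refine lift_br (fun p => (br (u : V ⧸ L))⁻¹ * br (u • p)) ?_ p
  have : u • ((1 : V) : V ⧸ L) = (u : V ⧸ L) := by
    rw [MulAction.Quotient.smul_coe, smul_eq_mul, mul_one]
  rw [this, inv_mul_cancel]

theorem actH_one : actH (1 : V) = MonoidHom.id (FY L) :=
  FY_ext fun p => by rw [actH_br, br_one, one_smul]; simp

theorem actH_mul (u v : V) : (actH (L := L) u).comp (actH v) = actH (u * v) :=
  FY_ext fun p => by
    have : u • (v : V ⧸ L) = ((u * v : V) : V ⧸ L) := by
      rw [MulAction.Quotient.smul_coe, smul_eq_mul]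
    rw [MonoidHom.comp_apply, actH_br, map_mul, map_inv, actH_br, actH_br, actH_br, this, mul_smul]
    group

variable (L) in
noncomputable def actA : V →* MulAut (FY L) where
  toFun u := MonoidHom.toMulEquiv (actH u) (actH u⁻¹) 
    (by rw [actH_mul, inv_mul_cancel, actH_one]) (by rw [actH_mul, mul_inv_cancel, actH_one])
  map_one' := by
    ext1 w
    exact DFunLike.congr_fun actH_one w
  map_mul' u v := by
    ext1 w
    exact (DFunLike.congr_fun (actH_mul u v) w).symm

theorem actA_apply (u : V) (w : FY L) : actA L u w = actH u w := rfl

variable (L) in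
/-- The amalgamated double of `V` along `L`. -/
abbrev SS := FY L ⋊[actA L] V

variable (L) in
noncomputable def i1 : V →* SS L := SemidirectProduct.inr
variable (L) in
noncomputable def i2 : V →* SS L where
  toFun v := ⟨br (v : V ⧸ L), v⟩
  map_one' := by ext1; exact br_one; rfl
  map_mul' u v := by
    ext1
    · show _ = br _ * actA L u (br _)
      rw [actA_apply, actH_br, MulAction.Quotient.smul_coe, smul_eq_mul]
      group
    · rfl
variable (L) in
noncomputable def fold : SS L →* V := SemidirectProduct.rightHom

@[simp] theorem fold_i1 (v : V) : fold L (i1 L v) = v := rfl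
@[simp] theorem fold_i2 (v : V) : fold L (i2 L v) = v := rfl

theorem i12 (g : V) (hg : g ∈ L) : i1 L g = i2 L g := by
  ext1
  · show 1 = br (g : V ⧸ L)
    have : (g : V ⧸ L) = ((1 : V) : V ⧸ L) := QuotientGroup.eq.2 (by simpa using L.inv_mem hg)
    rw [this, br_one]
  · rfl

theorem i2_i1 (v : V) : i2 L v * (i1 L v)⁻¹ = SemidirectProduct.inl (br (v : V ⧸ L)) := by
  rw [mul_inv_eq_iff_eq_mul]
  ext1
  · show _ = br _ * actA L 1 1
    rw [map_one, mul_one]; rfl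
  · show v = 1 * v
    rw [one_mul]

/-- generation -/
theorem SS_gen (N : Subgroup (SS L)) (h1 : ∀ v, i1 L v ∈ N) (h2 : ∀ v, i2 L v ∈ N) : N = ⊤ := by
  have hb : ∀ w : FY L, SemidirectProduct.inl w ∈ N := by
    intro w
    induction w using FreeGroup.induction_on with
    | C1 => rw [map_one]; exact N.one_mem
    | of y =>
      obtain ⟨v, hv⟩ := QuotientGroup.mk_surjective y.1
      have := N.mul_mem (h2 v) (N.inv_mem (h1 v))
      rw [i2_i1] at this
      have e : br (v : V ⧸ L) = FreeGroup.of y := by rw [← br_of y, ← hv]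
      rwa [e] at this
    | inv_of y h => rw [map_inv]; exact N.inv_mem h
    | mul x y hx hy => rw [map_mul]; exact N.mul_mem hx hy
  rw [eq_top_iff]
  rintro s -
  have := N.mul_mem (hb s.left) (h1 s.right)
  rwa [i1, SemidirectProduct.inl_left_mul_inr_right] at this

theorem SS_ext {E : Type*} [Group E] {f g : SS L →* E} (h1 : ∀ v, f (i1 L v) = g (i1 L v))
    (h2 : ∀ v, f (i2 L v) = g (i2 L v)) (s : SS L) : f s = g s := by
  have := SS_gen (f.eqLocus g) h1 h2
  have hs : s ∈ (⊤ : Subgroup (SS L)) := trivial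
  rw [← this] at hs
  exact hs

theorem SS_lift {E : Type*} [Group E] (φ ψ : V →* E) (h : ∀ g ∈ L, φ g = ψ g) :
    ∃ f : SS L →* E, (∀ v, f (i1 L v) = φ v) ∧ (∀ v, f (i2 L v) = ψ v) := by
  let θ : V ⧸ L → E := fun p => Quotient.liftOn' p (fun v => ψ v * (φ v)⁻¹) (by
    intro a b hab
    rw [QuotientGroup.leftRel_apply] at hab
    have e := h _ hab
    simp only [map_mul, map_inv] at e
    have : φ b = φ a * ((ψ a)⁻¹ * ψ b) := by rw [← e]; group
    beta_reduce
    rw [this]; group)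
  have hθ : ∀ v : V, θ (v : V ⧸ L) = ψ v * (φ v)⁻¹ := fun v => rfl
  have h1 : θ (1 : V) = 1 := by rw [hθ]; simp
  let Θ : FY L →* E := FreeGroup.lift (fun y : YY L => θ y.1)
  have hΘ : ∀ p, Θ (br p) = θ p := lift_br θ h1
  have key : ∀ u, Θ.comp ((actA L u).toMonoidHom) = (MulAut.conj (φ u)).toMonoidHom.comp Θ := by
    intro u
    refine FY_ext fun p => ?_
    obtain ⟨v, rfl⟩ := QuotientGroup.mk_surjective p
    show Θ (actH u _) = φ u * Θ _ * (φ u)⁻¹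
    rw [actH_br, map_mul, map_inv, hΘ, hΘ, hΘ, MulAction.Quotient.smul_coe, smul_eq_mul, hθ, hθ, hθ,
      map_mul, map_mul]
    group
  refine ⟨SemidirectProduct.lift Θ φ key, fun v => ?_, fun v => ?_⟩
  · exact SemidirectProduct.lift_inr _ _ _ v
  · show Θ (br v) * φ v = ψ v
    rw [hΘ, hθ]; group

/-- triviality of the centre -/
theorem map_fixed {X : Type*} [DecidableEq X] (f : X → X) (hf : Function.Injective f) (w : FreeGroup X)
    (h : FreeGroup.map f w = w) (a : X × Bool) (l : List (X × Bool)) (hw : w.toWord = a :: l) :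
    f a.1 = a.1 := by
  have hr : FreeGroup.IsReduced (w.toWord) := FreeGroup.isReduced_toWord
  have hr' : FreeGroup.IsReduced (w.toWord.map fun x => (f x.1, x.2)) := by
    unfold FreeGroup.IsReduced at *
    rw [List.isChain_map]
    refine hr.imp fun a b hab h => hab (hf h)
  have e : (FreeGroup.map f w).toWord = w.toWord.map fun x => (f x.1, x.2) := by
    conv_lhs => rw [← FreeGroup.mk_toWord (x := w)]
    rw [FreeGroup.map.mk, FreeGroup.toWord_mk]
    exact hr'.reduce_eq
  rw [h, hw, List.map_cons] at e
  have := (List.cons.inj e).1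
  exact (congrArg Prod.fst this).symm

theorem SS_center (hV : ∀ z : V, (∀ v, z * v = v * z) → z = 1) (hL : L ≠ ⊤) (z : SS L)
    (hz : ∀ s, z * s = s * z) : z = 1 := by
  classical
  have hr : z.right = 1 := hV _ fun v => congrArg (fold L) (hz (i1 L v))
  have hfix : ∀ u : V, actH u z.left = z.left := by
    intro u
    have := congrArg SemidirectProduct.left (hz (i1 L u))
    change z.left * actA L z.right 1 = 1 * actA L u z.left at this
    rw [map_one, mul_one, one_mul] at this
    exact this.symm
  let J : FY L →* FreeGroup (V ⧸ L) :=
    FreeGroup.lift (fun y : YY L => (FreeGroup.of ((1 : V) : V ⧸ L))⁻¹ * FreeGroup.of y.1)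
  have hJ : ∀ p, J (br p) = (FreeGroup.of ((1 : V) : V ⧸ L))⁻¹ * FreeGroup.of p :=
    lift_br (fun p => (FreeGroup.of ((1 : V) : V ⧸ L))⁻¹ * FreeGroup.of p) (by simp)
  let R : FreeGroup (V ⧸ L) →* FY L := FreeGroup.lift br
  have hRJ : R.comp J = MonoidHom.id _ := FY_ext fun p => by
    simp [hJ, R, br_one]
  have hJa : ∀ u : V, J.comp (actH u) = (FreeGroup.map (fun p => u • p)).comp J := fun u =>
    FY_ext fun p => by
      have : u • ((1 : V) : V ⧸ L) = (u : V ⧸ L) := by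
        rw [MulAction.Quotient.smul_coe, smul_eq_mul, mul_one]
      simp only [MonoidHom.comp_apply, actH_br, map_mul, map_inv, hJ, FreeGroup.map.of, this]
      group
  have hJz : J z.left = 1 := by
    have hf : ∀ u : V, FreeGroup.map (fun p => u • p) (J z.left) = J z.left := fun u => by
      have := DFunLike.congr_fun (hJa u) z.left
      simp only [MonoidHom.comp_apply, hfix] at this
      exact this.symm
    rcases hw : (J z.left).toWord with _ | ⟨a, l⟩
    · exact FreeGroup.toWord_eq_nil_iff.1 hw
    · exfalso
      have h2 : ∀ u : V, u • a.1 = a.1 := fun u =>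
        map_fixed (fun p => u • p) (MulAction.injective u) _ (hf u) a l hw
      refine hL (eq_top_iff.2 fun x _ => ?_)
      obtain ⟨v, hv⟩ := QuotientGroup.mk_surjective a.1
      have h3 := h2 (v * x * v⁻¹)
      rw [← hv, MulAction.Quotient.smul_coe, smul_eq_mul] at h3
      have h4 := QuotientGroup.eq.1 h3
      have : x⁻¹ ∈ L := by
        convert h4 using 1
        group
      simpa using L.inv_mem this
  have hl : z.left = 1 := by
    have := DFunLike.congr_fun hRJ z.left
    rw [MonoidHom.comp_apply, hJz, map_one] at this
    exact this.symm
  ext1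
  · exact hl
  · exact hr

theorem SS_V1 (hV : V1 V) : V1 (SS L) := by
  intro c hc s
  let f : SS L →* Multiplicative T := ⟨⟨fun s => Multiplicative.ofAdd (c s), by rw [hc.one]; rfl⟩,
    fun a b => by 
      show Multiplicative.ofAdd (c (a * b)) = _
      rw [hc]; rfl⟩
  have := SS_ext (f := f) (g := 1) (fun v => ?_) (fun v => ?_) s
  · exact this
  · exact hV _ (hc.comp (i1 L)) v
  · exact hV _ (hc.comp (i2 L)) v

/-- splitting twisted cocycles over the amalgam -/
theorem SS_tw {M : Type*} [AddCommGroup M] (c : TwCoc (SS L) M) (f1 f2 : V → M)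
    (h1 : ∀ u v, f1 (u * v) = f1 u + c.ρ (i1 L u) (f1 v) + c.F (i1 L u) (i1 L v))
    (h2 : ∀ u v, f2 (u * v) = f2 u + c.ρ (i2 L u) (f2 v) + c.F (i2 L u) (i2 L v))
    (h : ∀ g ∈ L, f1 g = f2 g) :
    ∃ f : SS L → M, (∀ s t, f (s * t) = f s + c.ρ s (f t) + c.F s t) ∧
      (∀ v, f (i1 L v) = f1 v) ∧ (∀ v, f (i2 L v) = f2 v) := by
  let φ : V →* TwExt c := MonoidHom.mk' (fun v => ⟨f1 v, i1 L v⟩) (fun u v => by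
    ext1
    · exact h1 u v
    · exact map_mul _ _ _)
  let ψ : V →* TwExt c := MonoidHom.mk' (fun v => ⟨f2 v, i2 L v⟩) (fun u v => by
    ext1
    · exact h2 u v
    · exact map_mul _ _ _)
  obtain ⟨F, e1, e2⟩ := SS_lift φ ψ (fun g hg => TwExt.ext (h g hg) (i12 g hg))
  have hp : ∀ s, (F s).snd = s := SS_ext (f := TwExt.proj.comp F) (g := MonoidHom.id _)
    (fun v => by rw [MonoidHom.comp_apply, e1]; rfl) (fun v => by rw [MonoidHom.comp_apply, e2]; rfl)
  refine ⟨fun s => (F s).fst, fun s t => ?_, fun v => by beta_reduce; rw [e1]; rfl,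
    fun v => by beta_reduce; rw [e2]; rfl⟩
  beta_reduce
  rw [map_mul, TwExt.mul_fst, hp, hp]

theorem SS_V2 (hV : V2 V) (hL : V1 L) : V2 (SS L) := by
  intro c hc
  obtain ⟨d, hd, n1, n2, hB⟩ := hc.exists_norm
  suffices B2 d from (hB.add this).congr fun g h => by beta_reduce; abel
  obtain ⟨f1, h1⟩ := hV _ (hd.comp (i1 L))
  obtain ⟨f2, h2⟩ := hV _ (hd.comp (i2 L))
  beta_reduce at h1 h2
  have h0 : ∀ g : L, f1 g - f2 g = 0 := hL _ (fun g h => by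
    have e1 := h1 g h
    have e2 := h2 g h
    rw [i12 _ g.2, i12 _ h.2] at e1
    rw [e1] at e2
    show f1 (g * h) - f2 (g * h) = _
    linear_combination (norm := abel) - e2)
  obtain ⟨f, hf, -, -⟩ := SS_tw (hd.tw n1 n2) (fun v => - f1 v) (fun v => - f2 v)
    (fun u v => by
      show - f1 (u * v) = - f1 u + - f1 v + d _ _
      rw [h1]; abel)
    (fun u v => by
      show - f2 (u * v) = - f2 u + - f2 v + d _ _
      rw [h2]; abel)
    (fun g hg => by
      have := h0 ⟨g, hg⟩
      rw [sub_eq_zero.1 this])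
  refine ⟨fun s => - f s, fun s t => ?_⟩
  have : f (s * t) = f s + f t + d s t := hf s t
  beta_reduce
  rw [this]; abel

end amalgam
end RCQ

namespace RCQ
set_option linter.all false

section lemE
variable {V : Type} [Group V] {L : Subgroup V}

theorem exists_lam {S : Type*} [Group S] (fo : S →* V) (i : V →* S) (hfi : ∀ v, fo (i v) = v)
    (φ : S → S → S → T) (hφ : Z3 φ) (f : V → V → T)
    (hf : ∀ g h k, φ (i g) (i h) (i k) = f h k - f (g * h) k + f g (h * k) - f g h) :
    ∃ lam : V → S → T, ∀ x s t,
      φ x (i s) (i t) = f s t + lam t (x * i s) - lam (s * t) x + lam s x := by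
  refine ⟨fun s x => φ (x * (i (fo x))⁻¹) (i (fo x)) (i s) - f (fo x) s, fun x s t => ?_⟩
  have h1 := hφ (x * (i (fo x))⁻¹) (i (fo x)) (i s) (i t)
  have h2 := hf (fo x) s t
  have e : x * i s * (i (fo x) * i s)⁻¹ = x * (i (fo x))⁻¹ := by group
  simp only [map_mul, hfi, e, inv_mul_cancel_right] at *
  linear_combination (norm := abel) - h1 + h2

variable (L) in
noncomputable def rr (p : V ⧸ L) : V := p.out * (((1 : V) : V ⧸ L).out)⁻¹

theorem rr_mk (p : V ⧸ L) : ((rr L p : V) : V ⧸ L) = p := by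
  conv_rhs => rw [← QuotientGroup.out_eq' p]
  rw [rr, QuotientGroup.eq]
  have : (((1 : V) : V ⧸ L).out) ∈ L := by
    have := QuotientGroup.eq.1 (QuotientGroup.out_eq' ((1 : V) : V ⧸ L))
    simpa using this
  simpa [mul_assoc] using this
theorem rr_one : rr L ((1 : V) : V ⧸ L) = 1 := by simp [rr]

theorem lemE (φ : SS L → SS L → SS L → T) (hφ : Z3 φ) (f1 f2 : V → V → T) (g : L → T)
    (h1 : ∀ a b c, φ (i1 L a) (i1 L b) (i1 L c) = f1 b c - f1 (a * b) c + f1 a (b * c) - f1 a b)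
    (h2 : ∀ a b c, φ (i2 L a) (i2 L b) (i2 L c) = f2 b c - f2 (a * b) c + f2 a (b * c) - f2 a b)
    (h : ∀ a b : L, f1 a b - f2 a b = g b - g (a * b) + g a) 
    (n2 : ∀ a b, φ a 1 b = 0) (n3 : ∀ a b, φ a b 1 = 0) : B3 φ := by
  obtain ⟨l1, e1⟩ := exists_lam (fold L) (i1 L) fold_i1 φ hφ f1 h1
  obtain ⟨l2, e2⟩ := exists_lam (fold L) (i2 L) fold_i2 φ hφ f2 h2
  let μ : L → SS L → T := fun s x => l1 s x - l2 s x + g s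
  have hμ : ∀ s t x, μ (s * t) x = μ t (x * i1 L s) + μ s x := by
    intro s t x
    have a1 := e1 x s t
    have a2 := e2 x s t
    have a3 := h s t
    rw [← i12 _ s.2, ← i12 _ t.2] at a2
    simp only [μ, Subgroup.coe_mul]
    linear_combination (norm := abel) a1 - a2 + a3
  let γ : SS L → L := fun x => ⟨(rr L (fold L x : V ⧸ L))⁻¹ * fold L x,
    QuotientGroup.eq.1 (rr_mk _)⟩
  have hγ : ∀ x (s : L), γ (x * i1 L s) = γ x * s := by
    intro x s
    apply Subtype.ext
    have : ((fold L x * (s : V) : V) : V ⧸ L) = (fold L x : V ⧸ L) :=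
      QuotientGroup.eq.2 (by simpa using L.inv_mem s.2)
    simp only [γ, map_mul, fold_i1, this, Subgroup.coe_mul, mul_assoc]
  let ν : SS L → T := fun x => μ (γ x) (x * (i1 L (γ x))⁻¹)
  have hν : ∀ x (s : L), μ s x = ν (x * i1 L s) - ν x := by
    intro x s
    have e : x * i1 L s * (i1 L (γ x * s : L))⁻¹ = x * (i1 L (γ x))⁻¹ := by
      simp only [Subgroup.coe_mul, map_mul]; group
    simp only [ν, hγ, e, hμ, inv_mul_cancel_right]
    abel
  let C : AddSubgroup (SS L → T) :=
    { carrier := {f | ∃ c, ∀ x, f x = c}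
      zero_mem' := ⟨0, fun _ => rfl⟩
      add_mem' := by
        rintro a b ⟨c, hc⟩ ⟨d, hd⟩
        exact ⟨c + d, fun x => by simp [hc, hd]⟩
      neg_mem' := by
        rintro a ⟨c, hc⟩
        exact ⟨- c, fun x => by simp [hc]⟩ }
  let R : SS L → (SS L → T) →+ (SS L → T) := fun s =>
    { toFun := fun f x => f (x * s), map_zero' := rfl, map_add' := fun _ _ => rfl }
  have hR : ∀ s, C ≤ C.comap (R s) := by
    rintro s f ⟨c, hc⟩
    exact ⟨c, fun x => hc _⟩
  let Rq : SS L → ((SS L → T) ⧸ C →+ (SS L → T) ⧸ C) := fun s => QuotientAddGroup.map C C (R s) (hR s)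
  have hRq : ∀ s f, Rq s (QuotientAddGroup.mk f) = QuotientAddGroup.mk (R s f) := fun s f => rfl
  have eqC : ∀ f k : SS L → T, (QuotientAddGroup.mk f : (SS L → T) ⧸ C) = QuotientAddGroup.mk k ↔
      ∃ c, ∀ x, k x - f x = c := by
    intro f k
    rw [QuotientAddGroup.eq]
    refine exists_congr fun c => forall_congr' fun x => ?_
    rw [Pi.add_apply, Pi.neg_apply, neg_add_eq_sub]
  let c : TwCoc (SS L) ((SS L → T) ⧸ C) :=
    { ρ :=
        { toFun := Rq
          map_one' := by
            refine AddMonoidHom.ext fun m => ?_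
            obtain ⟨f, rfl⟩ := QuotientAddGroup.mk_surjective m
            rw [hRq]
            refine congrArg _ (funext fun x => ?_)
            exact congrArg f (mul_one x)
          map_mul' := fun s t => by
            refine AddMonoidHom.ext fun m => ?_
            obtain ⟨f, rfl⟩ := QuotientAddGroup.mk_surjective m
            rw [hRq]
            refine Eq.trans ?_ (congrFun (AddMonoid.End.coe_mul (M := (SS L → T) ⧸ C) (Rq s) (Rq t)) _).symm
            refine Eq.trans ?_ (congrArg (Rq s) (hRq t f)).symm
            refine Eq.trans ?_ (hRq s _).symm
            refine congrArg _ (funext fun x => ?_)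
            exact congrArg f (mul_assoc x s t).symm }
      F := fun s t => QuotientAddGroup.mk (fun x => φ x s t)
      coc := fun s t u => by
        show Rq s _ - _ + _ - _ = 0
        rw [hRq, ← QuotientAddGroup.mk_sub, ← QuotientAddGroup.mk_add, ← QuotientAddGroup.mk_sub,
          QuotientAddGroup.eq_zero_iff]
        refine ⟨φ s t u, fun x => ?_⟩
        have := hφ x s t u
        simp only [Pi.sub_apply, Pi.add_apply]
        show φ (x * s) t u - _ + _ - _ = _
        linear_combination (norm := abel) - this
      one_left := fun s => (QuotientAddGroup.eq_zero_iff _).2 ⟨0, fun x => n2 x s⟩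
      one_right := fun s => (QuotientAddGroup.eq_zero_iff _).2 ⟨0, fun x => n3 x s⟩ }
  obtain ⟨Λ, hΛ, -, -⟩ := SS_tw c
    (fun v => QuotientAddGroup.mk (fun x => - (l1 v x - (ν (x * i1 L v) - ν x))))
    (fun v => QuotientAddGroup.mk (fun x => - l2 v x))
    (fun u v => by
      show QuotientAddGroup.mk _ = QuotientAddGroup.mk _ + Rq _ (QuotientAddGroup.mk _) + QuotientAddGroup.mk _
      rw [hRq, ← QuotientAddGroup.mk_add, ← QuotientAddGroup.mk_add, eqC]
      refine ⟨f1 u v, fun x => ?_⟩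
      have := e1 x u v
      simp only [Pi.add_apply, R, AddMonoidHom.coe_mk, ZeroHom.coe_mk, map_mul, mul_assoc] at this ⊢
      linear_combination (norm := abel) this)
    (fun u v => by
      show QuotientAddGroup.mk _ = QuotientAddGroup.mk _ + Rq _ (QuotientAddGroup.mk _) + QuotientAddGroup.mk _
      rw [hRq, ← QuotientAddGroup.mk_add, ← QuotientAddGroup.mk_add, eqC]
      refine ⟨f2 u v, fun x => ?_⟩
      have := e2 x u v
      simp only [Pi.add_apply, R, AddMonoidHom.coe_mk, ZeroHom.coe_mk] at this ⊢
      linear_combination (norm := abel) this)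
    (fun s hs => by
      rw [eqC]
      refine ⟨- g ⟨s, hs⟩, fun x => ?_⟩
      have := hν x ⟨s, hs⟩
      simp only [μ] at this
      linear_combination (norm := abel) this)
  choose lam hlam using fun s => QuotientAddGroup.mk_surjective (Λ s)
  have key : ∀ s t, ∃ e, ∀ x, lam s x + lam t (x * s) + φ x s t - lam (s * t) x = e := by
    intro s t
    have := hΛ s t
    rw [← hlam, ← hlam, ← hlam] at this
    change QuotientAddGroup.mk _ = QuotientAddGroup.mk _ + Rq _ (QuotientAddGroup.mk _) + QuotientAddGroup.mk _ at this
    rw [hRq, ← QuotientAddGroup.mk_add, ← QuotientAddGroup.mk_add, eqC] at this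
    exact this
  choose e he using key
  refine ⟨e, fun s t u => ?_⟩
  have k1 := he t u (1 * s)
  have k2 := he (s * t) u 1
  have k3 := he s (t * u) 1
  have k4 := he s t 1
  have k5 := hφ 1 s t u
  simp only [mul_assoc, one_mul] at *
  linear_combination (norm := abel) k5 + k1 - k2 + k3 - k4

theorem lemE' (φ : SS L → SS L → SS L → T) (hφ : Z3 φ) (f1 f2 : V → V → T) (g : L → T)
    (h1 : ∀ a b c, φ (i1 L a) (i1 L b) (i1 L c) = f1 b c - f1 (a * b) c + f1 a (b * c) - f1 a b)
    (h2 : ∀ a b c, φ (i2 L a) (i2 L b) (i2 L c) = f2 b c - f2 (a * b) c + f2 a (b * c) - f2 a b)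
    (h : ∀ a b : L, f1 a b - f2 a b = g b - g (a * b) + g a) : B3 φ := by
  obtain ⟨d, hd, n1, n2, n3, b, hb⟩ := hφ.exists_norm
  suffices B3 d from (B3.add ⟨b, hb⟩ this).congr fun g h k => by beta_reduce; abel
  refine lemE d hd (fun u v => f1 u v - b (i1 L u) (i1 L v)) (fun u v => f2 u v - b (i2 L u) (i2 L v))
    g (fun u v w => ?_) (fun u v w => ?_) (fun u v => ?_) n2 n3
  · have := hb (i1 L u) (i1 L v) (i1 L w)
    have := h1 u v w
    simp only [map_mul] at *
    grind
  · have := hb (i2 L u) (i2 L v) (i2 L w)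
    have := h2 u v w
    simp only [map_mul] at *
    grind
  · rw [i12 _ u.2, i12 _ v.2]
    linear_combination (norm := abel) h u v
end lemE
end RCQ

namespace RCQ
set_option linter.all false

section pairing
variable {X M : Type*} [AddCommGroup M]

noncomputable def pr (f : X → M) : (X →₀ ℤ) →+ M :=
  Finsupp.liftAddHom (fun p => zmultiplesHom M (f p))

theorem pr_single (f : X → M) (p : X) : pr f (Finsupp.single p 1) = f p := by
  simp [pr]

theorem pr_mapDomain {Y : Type*} (f : Y → M) (g : X → Y) (x : X →₀ ℤ) :
    pr f (Finsupp.mapDomain g x) = pr (fun p => f (g p)) x := by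
  induction x using Finsupp.induction_linear with
  | zero => simp
  | add a b ha hb => rw [Finsupp.mapDomain_add, map_add, map_add, ha, hb]
  | single a n => simp [pr, Finsupp.mapDomain_single]

theorem pr_four (f1 f2 f3 f4 : X → M) (h : ∀ p, f1 p - f2 p + f3 p - f4 p = 0) (x : X →₀ ℤ) :
    pr f1 x - pr f2 x + pr f3 x - pr f4 x = 0 := by
  induction x using Finsupp.induction_linear with
  | zero => simp
  | add a b ha hb =>
    simp only [map_add]
    linear_combination (norm := abel) ha + hb
  | single a n =>
    have := congrArg (fun t => n • t) (h a)
    simpa [pr, smul_sub, smul_add] using this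
end pairing

section rep3
variable {V : Type} [Group V] {L : Subgroup V}

noncomputable def aa (u : V) (p : V ⧸ L) : L :=
  ⟨(rr L p)⁻¹ * u * rr L (u⁻¹ • p), by
    rw [mul_assoc]
    refine QuotientGroup.eq.1 ?_
    rw [rr_mk]
    have : ((u * rr L (u⁻¹ • p) : V) : V ⧸ L) = u • ((rr L (u⁻¹ • p) : V) : V ⧸ L) := rfl
    rw [this, rr_mk, smul_inv_smul]⟩

theorem aa_mul (u v : V) (p : V ⧸ L) : aa (u * v) p = aa u p * aa v (u⁻¹ • p) := by
  apply Subtype.ext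
  simp only [aa, Subgroup.coe_mul, mul_inv_rev, mul_smul]
  group

theorem aa_one (u : L) : aa (u : V) ((1 : V) : V ⧸ L) = u := by
  apply Subtype.ext
  have : (u : V)⁻¹ • ((1 : V) : V ⧸ L) = ((1 : V) : V ⧸ L) := by
    show (((u : V)⁻¹ * 1 : V) : V ⧸ L) = _
    refine QuotientGroup.eq.2 ?_
    simp
  simp only [aa, this, rr_one]
  simp

theorem exists_xi : ∃ ξ : SS L → (V ⧸ L →₀ ℤ),
    (∀ s t, ξ (s * t) = ξ s + Finsupp.mapDomain (fun p => fold L s • p) (ξ t)) ∧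
    (∀ v, ξ (i1 L v) = 0) ∧
    (∀ v : V, ξ (i2 L v) = Finsupp.single (v : V ⧸ L) 1 - Finsupp.single ((1 : V) : V ⧸ L) 1) := by
  let c : TwCoc (SS L) (V ⧸ L →₀ ℤ) :=
    { ρ :=
        { toFun := fun s => Finsupp.mapDomain.addMonoidHom (fun p => fold L s • p)
          map_one' := by
            refine AddMonoidHom.ext fun m => ?_
            show Finsupp.mapDomain _ m = m
            simp only [map_one, one_smul]
            exact Finsupp.mapDomain_id
          map_mul' := fun s t => by
            refine AddMonoidHom.ext fun m => ?_
            refine Eq.trans ?_ (congrFun (AddMonoid.End.coe_mul (M := (V ⧸ L →₀ ℤ)) _ _) _).symm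
            show Finsupp.mapDomain _ m = Finsupp.mapDomain _ (Finsupp.mapDomain _ m)
            rw [← Finsupp.mapDomain_comp]
            congr 1
            funext p
            simp [mul_smul] }
      F := fun _ _ => 0
      coc := fun _ _ _ => by simp
      one_left := fun _ => rfl
      one_right := fun _ => rfl }
  obtain ⟨f, h0, h1, h2⟩ := SS_tw c (fun _ => 0)
    (fun v => Finsupp.single (v : V ⧸ L) 1 - Finsupp.single ((1 : V) : V ⧸ L) 1)
    (fun u v => by simp [c]) (fun u v => by
      show _ = _ + Finsupp.mapDomain _ _ + 0
      rw [fold_i2, Finsupp.mapDomain_sub, Finsupp.mapDomain_single, Finsupp.mapDomain_single]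
      have e1 : u • ((v : V) : V ⧸ L) = ((u * v : V) : V ⧸ L) := rfl
      have e2 : u • ((1 : V) : V ⧸ L) = ((u : V) : V ⧸ L) := congrArg _ (mul_one u)
      rw [e1, e2]
      abel)
    (fun g hg => by
      have : (g : V ⧸ L) = ((1 : V) : V ⧸ L) := QuotientGroup.eq.2 (by simpa using hg)
      rw [this, sub_self])
  exact ⟨f, fun s t => (h0 s t).trans (add_zero _), h1, h2⟩

theorem SS_rep3 {M : Type} [AddCommGroup M] {κ : L → L → M} (hκ : Rep2 L M κ)
    (hV2 : V2 V) (hV3 : V3 V) : ∃ c, Rep3 (SS L) M c := by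
  obtain ⟨ξ, hξ, hξ1, hξ2⟩ := exists_xi (L := L)
  let ρ : V → V → V ⧸ L → M := fun u v p => κ (aa u p) (aa v (u⁻¹ • p))
  have hρ : ∀ u v w p, ρ v w (u⁻¹ • p) - ρ (u * v) w p + ρ u (v * w) p - ρ u v p = 0 := by
    intro u v w p
    have := hκ.coc (aa u p) (aa v (u⁻¹ • p)) (aa w (v⁻¹ • u⁻¹ • p))
    simp only [ρ, aa_mul, mul_inv_rev, mul_smul]
    exact this
  let f : V → V → M := fun u v => ρ u v ((u * v : V) : V ⧸ L)
  have hfL : ∀ a b : L, f a b = κ a b := by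
    intro a b
    have e : (((a : V) * b : V) : V ⧸ L) = ((1 : V) : V ⧸ L) :=
      QuotientGroup.eq.2 (by simpa using (L.inv_mem (a * b).2))
    have e2 : (a : V)⁻¹ • ((1 : V) : V ⧸ L) = ((1 : V) : V ⧸ L) := by
      show (((a : V)⁻¹ * 1 : V) : V ⧸ L) = _
      refine QuotientGroup.eq.2 ?_
      simp
    simp only [f, ρ, e, e2, aa_one]
  let c : SS L → SS L → SS L → M := fun s t u =>
    pr (fun p => ρ (fold L s) (fold L t) ((fold L s * fold L t) • p)) (ξ u)
  have hc : Z3 c := by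
    intro s1 s2 s3 s4
    have := pr_four (fun p => ρ (fold L s2) (fold L s3) ((fold L s2 * fold L s3) • p))
      (fun p => ρ (fold L s1 * fold L s2) (fold L s3) ((fold L s1 * fold L s2 * fold L s3) • p))
      (fun p => ρ (fold L s1) (fold L s2 * fold L s3) ((fold L s1 * (fold L s2 * fold L s3)) • p))
      (fun p => ρ (fold L s1) (fold L s2) ((fold L s1 * fold L s2) • fold L s3 • p)) (fun p => by
        have := hρ (fold L s1) (fold L s2) (fold L s3) ((fold L s1 * fold L s2 * fold L s3) • p)
        simp only [mul_smul, inv_smul_smul] at this ⊢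
        exact this) (ξ s4)
    simp only [c, hξ, map_mul, map_add, pr_mapDomain]
    linear_combination (norm := abel) this
  have c1 : ∀ a b d, c (i1 L a) (i1 L b) (i1 L d) = 0 := by
    intro a b d
    simp only [c, hξ1, map_zero]
  have c2 : ∀ a b d, c (i2 L a) (i2 L b) (i2 L d) = f b d - f (a * b) d + f a (b * d) - f a b := by
    intro a b d
    simp only [c, hξ2, map_sub, pr_single, fold_i2]
    have := hρ a b d ((a * b * d : V) : V ⧸ L)
    have e1 : a⁻¹ • ((a * b * d : V) : V ⧸ L) = ((b * d : V) : V ⧸ L) := by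
      show ((a⁻¹ * (a * b * d) : V) : V ⧸ L) = _
      congr 1
      group
    have e2 : (a * b) • ((1 : V) : V ⧸ L) = ((a * b : V) : V ⧸ L) := congrArg _ (mul_one _)
    have e3 : (a * b) • (d : V ⧸ L) = ((a * b * d : V) : V ⧸ L) := rfl
    rw [e1] at this
    rw [e2, e3]
    simp only [f, ← mul_assoc] at this ⊢
    linear_combination (norm := abel) - this
  refine ⟨c, hc, ?_, ?_⟩
  · intro φ hφ
    obtain ⟨f1, hf1⟩ := hV3 _ (hφ.comp (i1 L))
    obtain ⟨f2, hf2⟩ := hV3 _ (hφ.comp (i2 L))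
    have hz : Z2 (fun a b : L => f1 a b - f2 a b) := by
      intro a b d
      have a1 := hf1 a b d
      have a2 := hf2 a b d
      simp only [i12 _ a.2, i12 _ b.2, i12 _ d.2] at a1
      simp only [Subgroup.coe_mul]
      linear_combination (norm := abel) a2 - a1
    obtain ⟨χ, g, hg⟩ := hκ.surj _ hz
    refine ⟨-χ, ?_⟩
    refine lemE' _ (hφ.sub (hc.map (-χ))) f1 (fun a b => f2 a b - (-χ) (f a b)) g ?_ ?_ ?_
    · intro a b d
      beta_reduce
      rw [c1, map_zero, sub_zero]
      exact hf1 a b d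
    · intro a b d
      have := hf2 a b d
      beta_reduce at *
      rw [c2, map_sub, map_add, map_sub]
      linear_combination (norm := abel) this
    · intro a b
      have := hg a b
      beta_reduce at this
      simp only [hfL, AddMonoidHom.neg_apply]
      linear_combination (norm := abel) this
  · rintro χ ⟨F, hF⟩
    apply hκ.inj
    obtain ⟨k1, hk1⟩ := hV2 (fun a b => F (i1 L a) (i1 L b)) (by
      intro a b d
      have := hF (i1 L a) (i1 L b) (i1 L d)
      beta_reduce at this
      rw [c1, map_zero] at this
      simp only [map_mul]
      exact this.symm)
    obtain ⟨k2, hk2⟩ := hV2 (fun a b => χ (f a b) - F (i2 L a) (i2 L b)) (by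
      intro a b d
      have := hF (i2 L a) (i2 L b) (i2 L d)
      beta_reduce at this
      rw [c2, map_sub, map_add, map_sub] at this
      simp only [map_mul]
      linear_combination (norm := abel) this)
    refine ⟨fun a => k1 a + k2 a, fun a b => ?_⟩
    have a1 := hk1 a b
    have a2 := hk2 a b
    simp only [i12 _ a.2, i12 _ b.2, hfL] at a1 a2
    simp only [Subgroup.coe_mul]
    linear_combination (norm := abel) a1 + a2
end rep3
end RCQ

namespace RCQ
set_option linter.all false

section transport
variable {G H : Type*} [Group G] [Group H] {M : Type*} [AddCommGroup M]

theorem V1.of_equiv (e : G ≃* H) (h : V1 G) : V1 H := by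
  intro c hc x
  have := h _ (hc.comp e.toMonoidHom) (e.symm x)
  simpa using this

theorem Rep2.of_equiv (e : G ≃* H) {κ : G → G → M} (h : Rep2 G M κ) :
    Rep2 H M (fun a b => κ (e.symm a) (e.symm b)) := by
  refine ⟨h.coc.comp e.symm.toMonoidHom, fun φ hφ => ?_, fun χ hχ => ?_⟩
  · obtain ⟨χ, hχ⟩ := h.surj _ (hφ.comp e.toMonoidHom)
    refine ⟨χ, ?_⟩
    have := hχ.comp e.symm.toMonoidHom
    simpa using this
  · apply h.inj
    have := hχ.comp e.toMonoidHom
    simpa using this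

theorem stg_of_equiv (e : G ≃* H) (h : StronglyTorsionGenerated G) :
    StronglyTorsionGenerated H := by
  intro n hn
  obtain ⟨g, hg, hN⟩ := h n hn
  refine ⟨e g, by rw [← hg]; exact MulEquiv.orderOf_eq e g, ?_⟩
  have : Subgroup.comap e.toMonoidHom (Subgroup.normalClosure {e g}) = ⊤ := by
    rw [eq_top_iff, ← hN]
    refine Subgroup.normalClosure_le_normal ?_
    rintro _ rfl
    exact Subgroup.subset_normalClosure rfl
  rw [eq_top_iff]
  rintro x -
  have h2 : e.symm x ∈ Subgroup.comap e.toMonoidHom (Subgroup.normalClosure {e g}) := by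
    rw [this]; trivial
  simpa using h2

theorem prod_V1 (hG : V1 G) (hH : V1 H) : V1 (G × H) := by
  intro c hc x
  have h1 := hG _ (hc.comp (MonoidHom.inl G H)) x.1
  have h2 := hH _ (hc.comp (MonoidHom.inr G H)) x.2
  have := hc (x.1, 1) (x.2 |> fun y => (1, y))
  simp at this h1 h2
  rw [h1, h2] at this
  simpa using this

theorem prod_rep2 (hG : V1 G) (hH : V2 H) {κ : G → G → M} (h : Rep2 G M κ) :
    Rep2 (G × H) M (fun a b => κ a.1 b.1) := by
  refine ⟨h.coc.comp (MonoidHom.fst G H), fun φ hφ => ?_, fun χ hχ => ?_⟩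
  · obtain ⟨χ, hχ⟩ := h.surj _ (hφ.comp (MonoidHom.inl G H))
    have h1 := hχ.comp (MonoidHom.fst G H)
    have h2 := (hH _ (hφ.comp (MonoidHom.inr G H))).comp (MonoidHom.snd G H)
    refine ⟨χ, (((cross2V φ hφ hG).add h1).add h2).congr fun a b => ?_⟩
    simp
    abel
  · apply h.inj
    exact hχ.comp (MonoidHom.inl G H)

theorem prod_rep3 (hG : V1 G) (hH : V1 H) (hG3 : V3 G) {κ : H → H → H → M} (h : Rep3 H M κ) :
    Rep3 (G × H) M (fun a b c => κ a.2 b.2 c.2) := by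
  refine ⟨h.coc.comp (MonoidHom.snd G H), fun φ hφ => ?_, fun χ hχ => ?_⟩
  · obtain ⟨χ, hχ⟩ := h.surj _ (hφ.comp (MonoidHom.inr G H))
    have h1 := hχ.comp (MonoidHom.snd G H)
    have h2 := (hG3 _ (hφ.comp (MonoidHom.inl G H))).comp (MonoidHom.fst G H)
    refine ⟨χ, (((cross3V φ hφ hG hH).add h1).add h2).congr fun a b c => ?_⟩
    simp
    abel
  · apply h.inj
    exact hχ.comp (MonoidHom.inr G H)

theorem V1.perfect (hG : V1 G) : commutator G = ⊤ := by
  rw [eq_top_iff]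
  rintro x -
  have := hG.hom (fun g => Additive.ofMul (Abelianization.of g)) (fun g h => by simp) x
  have h2 : Abelianization.of x = 1 := this
  rw [← Abelianization.ker_of]
  exact h2

open scoped commutatorElement in
theorem prod_aux (hG : V1 G) (g : G) (h : H) (hg : Subgroup.normalClosure {g} = ⊤)
    (N : Subgroup (G × H)) [hN : N.Normal] (hm : (g, h) ∈ N) (x : G) : (x, (1 : H)) ∈ N := by
  let N1 := N.comap (MonoidHom.inl G H)
  have hN1 : N1.Normal := inferInstance
  have hK : (Subgroup.center (G ⧸ N1)).comap (QuotientGroup.mk' N1) = ⊤ := by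
    rw [eq_top_iff, ← hg]
    refine Subgroup.normalClosure_le_normal ?_
    intro g' hg'
    rw [Set.mem_singleton_iff.1 hg', SetLike.mem_coe, Subgroup.mem_comap, Subgroup.mem_center_iff]
    intro y
    obtain ⟨y, rfl⟩ := QuotientGroup.mk_surjective y
    refine QuotientGroup.eq.2 ?_
    show ((y * g)⁻¹ * (g * y), (1 : H)) ∈ N
    have a := hN.conj_mem _ hm ((y, 1)⁻¹)
    have b := N.mul_mem (N.inv_mem hm) a
    have := hN.conj_mem _ b 1
    convert b using 1
    ext <;> simp [mul_assoc]
  have hc : commutator G ≤ N1 := by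
    rw [commutator_def, Subgroup.commutator_le]
    intro a _ b _
    have ha : a ∈ (Subgroup.center (G ⧸ N1)).comap (QuotientGroup.mk' N1) := by rw [hK]; trivial
    rw [Subgroup.mem_comap, Subgroup.mem_center_iff] at ha
    have := ha (QuotientGroup.mk' N1 b)
    rw [← QuotientGroup.eq_one_iff]
    have h2 : (QuotientGroup.mk' N1) ⁅a, b⁆ = 1 := by
      rw [map_commutatorElement, commutatorElement_eq_one_iff_mul_comm, this]
    exact h2
  rw [hG.perfect] at hc
  exact hc (Subgroup.mem_top x)

theorem prod_stg (hG : V1 G) (hH : V1 H) (sG : StronglyTorsionGenerated G)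
    (sH : StronglyTorsionGenerated H) : StronglyTorsionGenerated (G × H) := by
  intro n hn
  obtain ⟨g, og, hg⟩ := sG n hn
  obtain ⟨h, oh, hh⟩ := sH n hn
  refine ⟨(g, h), by rw [Prod.orderOf_mk, og, oh, Nat.lcm_self], ?_⟩
  have hm : (g, h) ∈ Subgroup.normalClosure {(g, h)} := Subgroup.subset_normalClosure rfl
  rw [eq_top_iff]
  rintro ⟨x, y⟩ -
  have a := prod_aux hG g h hg _ hm x
  have b := prod_aux hH h g hh ((Subgroup.normalClosure {(g, h)}).comap
    (MulEquiv.prodComm (M := H) (N := G)).toMonoidHom) hm y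
  have := Subgroup.mul_mem _ a b
  simpa using this

end transport
end RCQ

namespace RCQ
set_option linter.all false

section QQ
variable {A B W : Type} [AddCommGroup A] [AddCommGroup B] [Zero W]

/-- The central subgroup of translations by a subgroup of `A`. -/
def NN (W : Type) [Zero W] (ι : B →+ A) : Subgroup (UU A W) :=
  (tr.comp (AddMonoidHom.toMultiplicative ι)).range

theorem mem_NN {ι : B →+ A} {σ : UU A W} :
    σ ∈ NN W ι ↔ ∃ b : B, tr (Multiplicative.ofAdd (ι b)) = σ := by
  constructor
  · rintro ⟨b, hb⟩
    exact ⟨b.toAdd, hb⟩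
  · rintro ⟨b, hb⟩
    exact ⟨Multiplicative.ofAdd b, hb⟩

instance (ι : B →+ A) : (NN W ι).Normal := ⟨by
  intro n hn g
  obtain ⟨b, rfl⟩ := mem_NN.1 hn
  rw [← tr_central, mul_inv_cancel_right]
  exact hn⟩

abbrev QQ (W : Type) [Zero W] (ι : B →+ A) := UU A W ⧸ NN W ι

def QE (ι : B →+ A) (hι : Function.Injective ι) : CExt (UU A W) (QQ W ι) B where
  π := QuotientGroup.mk' _
  surj := QuotientGroup.mk'_surjective _
  j b := tr (Multiplicative.ofAdd (ι b))
  j_add a b := by rw [map_add, ofAdd_add, map_mul]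
  j_inj := fun a b h => hι (tr_inj h)
  π_j b := (QuotientGroup.eq_one_iff _).2 (mem_NN.2 ⟨b, rfl⟩)
  ker u hu := mem_NN.1 ((QuotientGroup.eq_one_iff _).1 hu)
  central b u := tr_central _ _

variable [Infinite W]
theorem QQ_V1 (ι : B →+ A) (hι : Function.Injective ι) : V1 (QQ W ι) := (QE ι hι).V1Q UU_V1
theorem QQ_V3 (ι : B →+ A) (hι : Function.Injective ι) : V3 (QQ W ι) := (QE ι hι).V3Q UU_V1 UU_V3
theorem QQ_rep2 (ι : B →+ A) (hι : Function.Injective ι) : ∃ κ, Rep2 (QQ W ι) B κ :=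
  ⟨_, (QE ι hι).rep2 UU_V1 UU_V2⟩

theorem QQ_stg (ι : B →+ A) : StronglyTorsionGenerated (QQ W ι) := by
  refine UU_stg_quot (QuotientGroup.mk' _) (QuotientGroup.mk'_surjective _) fun σ h => ?_
  obtain ⟨b, hb⟩ := mem_NN.1 ((QuotientGroup.eq_one_iff _).1 h)
  exact ⟨_, hb.symm⟩

theorem QQ_center (ι : B →+ A) (z : QQ W ι) (hz : ∀ s, z * s = s * z) :
    ∃ a, z = QuotientGroup.mk' _ (tr a) := by
  obtain ⟨c, rfl⟩ := QuotientGroup.mk'_surjective _ z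
  obtain ⟨a, ha⟩ := UU_center c (fun u => by
    have h1 := hz (QuotientGroup.mk' _ u)
    rw [← map_mul, ← map_mul] at h1
    obtain ⟨b, hb⟩ := mem_NN.1 (QuotientGroup.eq.1 h1)
    refine ⟨(Multiplicative.ofAdd (ι b))⁻¹, ?_⟩
    rw [map_inv, hb, mul_inv_rev, inv_inv, mul_assoc]
    have h3 := tr_central (W := W) (Multiplicative.ofAdd (ι b)) (u * c)
    have h4 := tr_central (W := W) (Multiplicative.ofAdd (ι b)) (c * u)
    rw [hb] at h3 h4
    have h5 : c * u = (u * c) * ((c * u)⁻¹ * (u * c))⁻¹ := by group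
    have h6 : ((c * u)⁻¹ * (u * c))⁻¹ * (u * c) = (u * c) * ((c * u)⁻¹ * (u * c))⁻¹ := by
      rw [inv_mul_eq_iff_eq_mul, ← mul_assoc, h3, mul_inv_cancel_right]
    rw [← h6] at h5
    refine h5.trans ?_
    group)
  exact ⟨a, by rw [ha]⟩

theorem QQ_inf (ι : B →+ A) : ∃ z : QQ W ι, ∀ n : ℤ, z ^ n = 1 → n = 0 := by
  obtain ⟨a, t, χ, -, h⟩ := exists_cyc W 2 le_rfl
  refine ⟨QuotientGroup.mk' _ (eU A 0 (a * t * a⁻¹ * t⁻¹)), fun n hn => ?_⟩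
  rw [← map_zpow, ← map_zpow] at hn
  obtain ⟨b, hb⟩ := mem_NN.1 ((QuotientGroup.eq_one_iff _).1 hn)
  have h1 := eU_tr _ _ _ hb.symm
  generalize a * t * a⁻¹ * t⁻¹ = π at *
  have key : ∀ n : ℕ, ∀ w, χ ((π ^ n) w) = χ w + n := by
    intro n
    induction n with
    | zero => simp
    | succ k ih =>
      intro w
      rw [pow_succ', Equiv.Perm.mul_apply, h, ih]
      push_cast
      ring
  have h2 : π ^ n.natAbs = 1 := by
    rcases Int.natAbs_eq n with h' | h'
    · rw [h', zpow_natCast] at h1; exact h1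
    · rw [h', zpow_neg, zpow_natCast, inv_eq_one] at h1; exact h1
  have := key n.natAbs 0
  rw [h2] at this
  simp at this
  exact this
end QQ

theorem exists_log {G : Type*} [Group G] (z : G) (hz : ∀ n : ℤ, z ^ n = 1 → n = 0) :
    ∃ k : G → ℤ, ∀ x, k (z * x) = k x + 1 := by
  have h0 : ∀ x : G, ∃ n : ℤ, z ^ n = ((x⁻¹ : G) : G ⧸ Subgroup.zpowers z).out⁻¹ * x⁻¹ := fun x =>
    Subgroup.mem_zpowers_iff.1 (QuotientGroup.eq.1 (QuotientGroup.out_eq' _))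
  choose n hn using h0
  refine ⟨fun x => - n x, fun x => ?_⟩
  have h1 := hn (z * x)
  have h2 := hn x
  have e : (((z * x)⁻¹ : G) : G ⧸ Subgroup.zpowers z) = ((x⁻¹ : G) : G ⧸ Subgroup.zpowers z) :=
    QuotientGroup.eq.2 (by simp)
  rw [e, mul_inv_rev, ← mul_assoc, ← h2] at h1
  have := hz (n (z * x) - n x + 1) (by
    rw [zpow_add, zpow_sub, h1, zpow_one, mul_assoc, mul_assoc]
    have : z⁻¹ * (z ^ n x)⁻¹ = (z ^ n x)⁻¹ * z⁻¹ := by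
      rw [← zpow_neg, ← zpow_neg_one, ← zpow_add, ← zpow_add, add_comm]
    rw [← mul_assoc z⁻¹, this]
    group)
  beta_reduce
  omega

theorem SS_stg {W : Type} [Zero W] [Infinite W] (L : Subgroup (UU Unit W)) (π : Equiv.Perm W)
    (χ : W → ℤ) (hχ : ∀ w, χ (π w) = χ w + 1) (hπ : eU Unit 0 π ∈ L) :
    StronglyTorsionGenerated (SS L) := by
  intro n hn
  obtain ⟨a, t, χ', ha, hχ'⟩ := exists_cyc W n hn
  refine ⟨i1 L (eU Unit 0 a), ?_, ?_⟩
  · rw [orderOf_injective (i1 L), orderOf_injective _ (eU_inj 0), ha]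
    exact Function.LeftInverse.injective (g := fold L) fold_i1
  · have h1 : (Subgroup.normalClosure {i1 L (eU Unit 0 a)}).comap (i1 L) = ⊤ :=
      eU_gen (n := n) hχ' _ (Subgroup.subset_normalClosure rfl)
    have h1' : ∀ v, i1 L v ∈ Subgroup.normalClosure {i1 L (eU Unit 0 a)} := fun v => by
      have : v ∈ (Subgroup.normalClosure {i1 L (eU Unit 0 a)}).comap (i1 L) := by
        rw [h1]; trivial
      exact this
    have h2 : (Subgroup.normalClosure {i1 L (eU Unit 0 a)}).comap (i2 L) = ⊤ := by
      refine shift_gen π χ hχ _ ?_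
      rw [Subgroup.mem_comap, ← i12 _ hπ]
      exact h1' _
    refine SS_gen _ h1' fun v => ?_
    have : v ∈ (Subgroup.normalClosure {i1 L (eU Unit 0 a)}).comap (i2 L) := by
      rw [h2]; trivial
    exact this

theorem exists_SC' {C : Type} [AddCommGroup C] {G : Type} [Group G] (h1 : V1 G) {κ : G → G → C}
    (h2 : Rep2 G C κ) (z : G) (hz : ∀ n : ℤ, z ^ n = 1 → n = 0) (W : Type) [Zero W] [Infinite W]
    (hW : Cardinal.mk G ≤ Cardinal.mk W) :
    ∃ (S : Type) (_ : Group S), V1 S ∧ V2 S ∧ (∃ κ, Rep3 S C κ) ∧ StronglyTorsionGenerated S ∧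
      ∀ z : S, (∀ s, z * s = s * z) → z = 1 := by
  obtain ⟨τ, χ, hχ⟩ := regRep G W hW
  obtain ⟨k, hk⟩ := exists_log z hz
  have τinj : Function.Injective τ := by
    refine (injective_iff_map_eq_one _).2 fun g hg => ?_
    have := hχ g 0
    rw [hg] at this
    exact right_eq_mul.1 this
  let f : G →* UU Unit W := (eU Unit 0).comp τ
  have finj : Function.Injective f := (eU_inj 0).comp τinj
  let e : G ≃* f.range := MonoidHom.ofInjective finj
  refine ⟨SS f.range, inferInstance, SS_V1 UU_V1, SS_V2 UU_V2 (h1.of_equiv e),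
    SS_rep3 (h2.of_equiv e) UU_V2 UU_V3, ?_, ?_⟩
  · refine SS_stg _ (τ z) (fun w => k (χ w)) (fun w => ?_) ⟨z, rfl⟩
    rw [hχ, hk]
  · refine SS_center (fun v hv => ?_) (fun htop => ?_)
    · obtain ⟨a, ha⟩ := UU_center v (fun u => ⟨1, by rw [map_one, one_mul, hv]⟩)
      rw [ha, Subsingleton.elim a 1, map_one]
    · obtain ⟨a, -, -, ha, -⟩ := exists_cyc W 2 le_rfl
      have : eU Unit 1 a ∈ f.range := by rw [htop]; trivial
      obtain ⟨g, hg⟩ := this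
      have : a = 1 := by
        ext w
        have := congrArg (fun σ : UU Unit W => (σ.1 (0, Finsupp.single 1 w)).2 1) hg
        have h3 : (eF (A := Unit) 0 (τ g) (0, Finsupp.single 1 w)).2 1 =
          (eF (A := Unit) 1 a (0, Finsupp.single 1 w)).2 1 := this
        rw [eF_ne (by norm_num), eF_snd] at h3
        simpa using h3.symm
      rw [this, orderOf_one] at ha
      omega

theorem exists_SC (C : Type) [AddCommGroup C] :
    ∃ (S : Type) (_ : Group S), V1 S ∧ V2 S ∧ (∃ κ, Rep3 S C κ) ∧ StronglyTorsionGenerated S ∧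
      ∀ z : S, (∀ s, z * s = s * z) → z = 1 := by
  have hi : Function.Injective (AddMonoidHom.id C) := Function.injective_id
  obtain ⟨κ, hκ⟩ := QQ_rep2 (W := ℕ) (AddMonoidHom.id C) hi
  obtain ⟨z, hz⟩ := QQ_inf (W := ℕ) (AddMonoidHom.id C)
  letI : Zero (QQ ℕ (AddMonoidHom.id C) × ℕ) := ⟨(1, 0)⟩
  exact exists_SC' (QQ_V1 _ hi) hκ z hz (QQ ℕ (AddMonoidHom.id C) × ℕ)
    (Cardinal.mk_le_of_injective (f := fun x => (x, 0)) fun a b h => congrArg Prod.fst h)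

theorem main_result
    (A B C : Type) [AddCommGroup A] [AddCommGroup B] [AddCommGroup C] :
    ∃ (S : Type) (_ : Group S),
      StronglyTorsionGenerated S ∧
      Nonempty (Subgroup.center S ≃* Multiplicative A) ∧
      Subsingleton (grpHomology S 1) ∧
      Nonempty (grpHomology S 2 ≃+ B) ∧
      Nonempty (grpHomology S 3 ≃+ C) ∧
      StronglyTorsionGenerated (S ⧸ Subgroup.center S) ∧
      Subgroup.center (S ⧸ Subgroup.center S) = ⊥ ∧
      Nonempty (grpHomology (S ⧸ Subgroup.center S) 2 ≃+ A × B) := by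
  obtain ⟨D, _, D1, D2, ⟨κ3, D3⟩, Ds, Dc⟩ := exists_SC C
  let ι : B →+ A × B := AddMonoidHom.inr A B
  have hι : Function.Injective ι := fun a b h => congrArg Prod.snd h
  let ι' : A × B →+ A × B := AddMonoidHom.id _
  have hι' : Function.Injective ι' := Function.injective_id
  obtain ⟨κ, hκ⟩ := QQ_rep2 (W := ℕ) ι hι
  obtain ⟨κ', hκ'⟩ := QQ_rep2 (W := ℕ) ι' hι'
  have hle : NN ℕ ι ≤ NN ℕ ι' := by
    intro σ hσ
    obtain ⟨b, hb⟩ := mem_NN.1 hσ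
    exact mem_NN.2 ⟨ι b, hb⟩
  let q : QQ ℕ ι →* QQ ℕ ι' := QuotientGroup.map _ _ (MonoidHom.id _) hle
  have hq : ∀ x, q (QuotientGroup.mk' _ x) = QuotientGroup.mk' _ x := fun x => rfl
  let F : QQ ℕ ι × D →* QQ ℕ ι' × D := q.prodMap (MonoidHom.id D)
  have hF : Function.Surjective F := by
    rintro ⟨x, d⟩
    obtain ⟨x, rfl⟩ := QuotientGroup.mk'_surjective _ x
    exact ⟨(QuotientGroup.mk' _ x, d), rfl⟩
  have hcen : ∀ (a : Multiplicative (A × B)) (s : QQ ℕ ι),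
      s * QuotientGroup.mk' _ (tr a) = QuotientGroup.mk' _ (tr a) * s := by
    intro a s
    obtain ⟨s, rfl⟩ := QuotientGroup.mk'_surjective _ s
    rw [← map_mul, ← map_mul, tr_central]
  have hcen' : ∀ z ∈ Subgroup.center (QQ ℕ ι × D), ∃ a, z = (QuotientGroup.mk' _ (tr a), 1) := by
    rintro ⟨x, d⟩ hz
    rw [Subgroup.mem_center_iff] at hz
    obtain ⟨a, ha⟩ := QQ_center ι x fun s => (congrArg Prod.fst (hz (s, 1))).symm
    have hd := Dc d fun s => (congrArg Prod.snd (hz (1, s))).symm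
    exact ⟨a, by rw [ha, hd]⟩
  have hmem : ∀ a, ((QuotientGroup.mk' (NN ℕ ι) (tr a), (1 : D))) ∈ Subgroup.center (QQ ℕ ι × D) := by
    intro a
    rw [Subgroup.mem_center_iff]
    rintro ⟨s, d⟩
    rw [Prod.mk_mul_mk, Prod.mk_mul_mk, hcen, mul_one, one_mul]
  have hker : Subgroup.center (QQ ℕ ι × D) = F.ker := by
    ext z
    constructor
    · intro hz
      obtain ⟨a, rfl⟩ := hcen' z hz
      refine Prod.ext ?_ rfl
      exact (QuotientGroup.eq_one_iff _).2 (mem_NN.2 ⟨a.toAdd, rfl⟩)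
    · obtain ⟨x, d⟩ := z
      intro hz
      have h1 : q x = 1 := congrArg Prod.fst hz
      have h2 : d = 1 := congrArg Prod.snd hz
      obtain ⟨x, rfl⟩ := QuotientGroup.mk'_surjective _ x
      rw [hq] at h1
      obtain ⟨b, hb⟩ := mem_NN.1 ((QuotientGroup.eq_one_iff _).1 h1)
      rw [h2, ← hb]
      exact hmem _
  let e : (QQ ℕ ι × D) ⧸ Subgroup.center (QQ ℕ ι × D) ≃* QQ ℕ ι' × D :=
    (QuotientGroup.quotientMulEquivOfEq hker).trans
      (QuotientGroup.quotientKerEquivOfSurjective F hF)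
  refine ⟨QQ ℕ ι × D, inferInstance, prod_stg (QQ_V1 ι hι) D1 (QQ_stg ι) Ds, ?_,
    (prod_V1 (QQ_V1 ι hι) D1).grpHomology, (prod_rep2 (QQ_V1 ι hι) D2 hκ).grpHomology,
    (prod_rep3 (QQ_V1 ι hι) D1 (QQ_V3 ι hι) D3).grpHomology,
    stg_of_equiv e.symm (prod_stg (QQ_V1 ι' hι') D1 (QQ_stg ι') Ds), ?_,
    ((prod_rep2 (QQ_V1 ι' hι') D2 hκ').of_equiv e.symm).grpHomology⟩
  · let j : Multiplicative A →* QQ ℕ ι × D := (MonoidHom.inl _ _).comp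
      ((QuotientGroup.mk' (NN ℕ ι)).comp (tr.comp (AddMonoidHom.toMultiplicative (AddMonoidHom.inl A B))))
    have hj : ∀ a, j a = (QuotientGroup.mk' _ (tr (Multiplicative.ofAdd (a.toAdd, 0))), 1) :=
      fun a => rfl
    have jinj : Function.Injective j := by
      refine (injective_iff_map_eq_one _).2 fun a ha => ?_
      rw [hj] at ha
      have := congrArg Prod.fst ha
      obtain ⟨b, hb⟩ := mem_NN.1 ((QuotientGroup.eq_one_iff _).1 this)
      have h2 := Multiplicative.ofAdd.injective (tr_inj hb)
      exact (congrArg Prod.fst h2).symm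
    have hr : j.range = Subgroup.center (QQ ℕ ι × D) := by
      ext z
      constructor
      · rintro ⟨a, rfl⟩
        exact hmem _
      · intro hz
        obtain ⟨a, rfl⟩ := hcen' z hz
        refine ⟨Multiplicative.ofAdd a.toAdd.1, ?_⟩
        rw [hj]
        refine Prod.ext ?_ rfl
        refine QuotientGroup.eq.2 (mem_NN.2 ⟨a.toAdd.2, ?_⟩)
        rw [← map_inv, ← map_mul]
        congr 1
        refine Multiplicative.toAdd.injective ?_
        refine Prod.ext ?_ ?_ <;> simp [ι]
    exact ⟨((MonoidHom.ofInjective jinj).trans (MulEquiv.subgroupCongr hr)).symm⟩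
  · rw [eq_bot_iff]
    intro z hz
    rw [Subgroup.mem_center_iff] at hz
    have hz' : ∀ s, e z * s = s * e z := by
      intro s
      have := congrArg e (hz (e.symm s))
      rw [map_mul, map_mul, e.apply_symm_apply] at this
      exact this.symm
    obtain ⟨a, ha⟩ := QQ_center ι' (e z).1 fun s => congrArg Prod.fst (hz' (s, 1))
    have hd := Dc (e z).2 fun s => congrArg Prod.snd (hz' (1, s))
    have h1 : (e z).1 = 1 := by
      rw [ha]
      exact (QuotientGroup.eq_one_iff _).2 (mem_NN.2 ⟨a.toAdd, rfl⟩)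
    have : e z = 1 := Prod.ext h1 hd
    exact (map_eq_one_iff e e.injective).1 this

end RCQ

theorem realization_with_central_quotient
    (A B C : Type) [AddCommGroup A] [AddCommGroup B] [AddCommGroup C] :
    ∃ (S : Type) (_ : Group S),
      StronglyTorsionGenerated S ∧
      Nonempty (Subgroup.center S ≃* Multiplicative A) ∧
      Subsingleton (grpHomology S 1) ∧
      Nonempty (grpHomology S 2 ≃+ B) ∧
      Nonempty (grpHomology S 3 ≃+ C) ∧
      StronglyTorsionGenerated (S ⧸ Subgroup.center S) ∧
      Subgroup.center (S ⧸ Subgroup.center S) = ⊥ ∧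
      Nonempty (grpHomology (S ⧸ Subgroup.center S) 2 ≃+ A × B) := by
  exact RCQ.main_result A B C
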